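/- arXiv:2307.10985 — 2 statements merged into one kernel-verified Lean document; each statement's English description precedes it below -/
import Mathlib

section
/- For every number of agents n ≥ 1 and every finite set M of m indivisible goods, if each agent i has an additive valuation with nonnegative item values v_i(k) ≥ 0, then there exists a complete allocation A = (A_1,…,A_n) that is (3/4 + 1/(12n))-MMS: for every agent i, v_i(A_i) ≥ (3/4 + 1/(12n))·μ_i, where μ_i = max over all partitions (P_1,…,P_n) of M into n bundles of min_j v_i(P_j). -/
namespace MaximinShare

open Finset

/-- The value under `v` of the goods below `m` that the labelling `p` puts into bundle `j`. -/
def bundleValue (m : ℕ) (v : ℕ → ℝ) (p : ℕ → ℕ) (j : ℕ) : ℝ :=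
  ∑ g ∈ range m with p g = j, v g

/-- The goods below `m` can be split into `n` bundles, each worth at most `1`, of total value at
least `c`. -/
def HasNormalizedPartition (m : ℕ) (v : ℕ → ℝ) (n : ℕ) (c : ℝ) : Prop :=
  ∃ (p : ℕ → ℕ) (J : Finset ℕ), J.card = n ∧ (∀ g, p g ∈ J) ∧
    (∀ j ∈ J, bundleValue m v p j ≤ 1) ∧ c ≤ ∑ g ∈ range m, v g

/-- Some `n` bundles of disjoint goods below `m` have total value at least `c`, when the value of
each bundle is capped at `1`. -/
def HasCappedPartition (m : ℕ) (v : ℕ → ℝ) (n : ℕ) (c : ℝ) : Prop :=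
  ∃ (p : ℕ → ℕ) (J : Finset ℕ), J.card = n ∧ c ≤ ∑ j ∈ J, min 1 (bundleValue m v p j)

lemma stuck_numeric {N n u : ℕ} (hun : u + 2 ≤ n) (hnN : n ≤ N) {γ x q S D Φ : ℝ}
    (hγ : γ = 1 / 4 - 1 / (12 * N)) (hx : 3 * x ≤ 1) (hγx : γ < x)
    (hq : q * γ ≤ S + D) (hS : S ≤ Φ) (hD : D ≤ (N - n) / (9 * N))
    (hΦ : Φ ≤ u * (4 / 3 - 2 * γ - 2 * x) + (1 - γ - 2 * x))
    (hE : u * (2 * γ - 1 / 3) + γ - (N - n) / (9 * N) ≤ q * x - D - S) : False := by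
  have hN : (2 : ℝ) ≤ N := by exact_mod_cast (by omega : 2 ≤ N)
  obtain ⟨z, hz⟩ : ∃ z : ℝ, z = 1 / N := ⟨_, rfl⟩
  have hzN : z * N = 1 := by rw [hz]; field_simp
  have hγz : γ = 1 / 4 - z / 12 := by rw [hγ, hz]; field_simp
  obtain ⟨D', hD'⟩ : ∃ D' : ℝ, D' = (N - n) / (9 * N) := ⟨_, rfl⟩
  rw [← hD'] at hD hE
  have hDz : D' = (1 - n * z) / 9 := by rw [hD', hz]; field_simp
  have hz0 : 0 < z := by rw [hz]; positivity
  have hz2 : z ≤ 1 / 2 := by nlinarith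
  have hn2 : (u : ℝ) + 2 ≤ n := by exact_mod_cast hun
  have hu0 : (0 : ℝ) ≤ u := Nat.cast_nonneg u
  have hD2 : D' ≤ 8 * γ / 3 - 5 / 9 := by rw [hDz]; nlinarith
  have hγ0 : 5 / 24 ≤ γ := by linarith
  have hγ1 : γ < 1 / 4 := by linarith
  have unit_slack : u * ((x - γ) * (4 / 3 - 2 * γ - 2 * x)) ≤ u * (γ * (2 * γ - 1 / 3)) := by
    rcases Nat.eq_zero_or_pos u with h | h
    · simp [h]
    · have hN3 : (3 : ℝ) ≤ N := by exact_mod_cast (by omega : 3 ≤ N)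
      have : z ≤ 1 / 3 := by nlinarith
      apply mul_le_mul_of_nonneg_left _ hu0
      nlinarith [sq_nonneg (x - 1 / 3)]
  have base_slack : (x - γ) * (1 - γ - 2 * x) + D' * x < γ * γ := by
    have h1 : (x - γ) * (1 - γ - 2 * x) ≤ (1 - 3 * γ) ^ 2 / 8 := by
      nlinarith [sq_nonneg (4 * x - γ - 1)]
    have h2 : D' * x ≤ (8 * γ / 3 - 5 / 9) / 3 := by nlinarith
    nlinarith
  have h3 : γ * (q * x - D - S) ≤ (x - γ) * (S + D) := by nlinarith
  have h4 : (x - γ) * (S + D) ≤ (x - γ) *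
      (u * (4 / 3 - 2 * γ - 2 * x) + (1 - γ - 2 * x) + D') := by
    apply mul_le_mul_of_nonneg_left _ (by linarith)
    linarith
  have h5 := mul_le_mul_of_nonneg_left hE (by linarith : 0 ≤ γ)
  nlinarith

/-- Final bag contents of a stuck bag filling, seen by one unsatisfied agent. Bag `k` starts with
the goods `k` and `2 * n - 1 - k`. -/
structure IsStuck (m n : ℕ) (α : ℝ) (v : ℕ → ℝ) (c : ℕ → ℕ) (k₀ : ℕ) : Prop where
  maps : ∀ g ∈ Ico (2 * n) m, c g ∈ range n
  lt : k₀ < n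
  deficient : v k₀ + v (2 * n - 1 - k₀) + ∑ g ∈ Ico (2 * n) m with c g = k₀, v g < α
  filled : ∀ k < n, (∑ g ∈ Ico (2 * n) m with c g = k, v g) = 0 ∨
    (v k + v (2 * n - 1 - k) < α ∧
      v k + v (2 * n - 1 - k) + ∑ g ∈ Ico (2 * n) m with c g = k, v g < α + v (2 * n))

lemma sum_pairs (v : ℕ → ℝ) {n a b : ℕ} (hn : 1 ≤ n) (hb : b ≤ n) :
    ∑ k ∈ Ico a b, v (2 * n - 1 - k) = ∑ g ∈ Ico (2 * n - b) (2 * n - a), v g := by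
  rw [Finset.sum_Ico_reflect _ _ (by omega)]
  congr 2 <;> omega

lemma IsStuck.sum_eq {m n : ℕ} {α : ℝ} {v : ℕ → ℝ} {c : ℕ → ℕ} {k₀ : ℕ}
    (h : IsStuck m n α v c k₀) (hm : 2 * n ≤ m) :
    ∑ k ∈ range n, (v k + v (2 * n - 1 - k) + ∑ g ∈ Ico (2 * n) m with c g = k, v g) =
      ∑ g ∈ range m, v g := by
  have hn : 1 ≤ n := by have := h.lt; omega
  rw [sum_add_distrib, sum_add_distrib, sum_fiberwise_of_maps_to h.maps, range_eq_Ico,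
    sum_pairs v hn le_rfl, range_eq_Ico, show 2 * n - n = n by omega,
    sum_Ico_consecutive _ (by omega) (by omega), Nat.sub_zero,
    sum_Ico_consecutive _ (by omega) hm]

/-- A stuck agent sees some initial bag worth more than `1`. -/
lemma IsStuck.exists_one_lt {m n N : ℕ} {v : ℕ → ℝ} {c : ℕ → ℕ} {k₀ : ℕ}
    (h : IsStuck m n (3 / 4 + 1 / (12 * N)) v c k₀) (hm : 2 * n ≤ m) (hnN : n ≤ N)
    (hsmall : 3 * v (2 * n) ≤ 3 / 4 + 1 / (12 * N))
    (htotal : n - (N - n) / (9 * N) ≤ ∑ g ∈ range m, v g) :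
    ∃ k < n, 1 < v k + v (2 * n - 1 - k) := by
  by_contra! hle
  have hk := h.lt
  have hN : (1 : ℝ) ≤ N := by exact_mod_cast (by omega : 1 ≤ N)
  have hn1 : (1 : ℝ) ≤ n := by exact_mod_cast (by omega : 1 ≤ n)
  have hnN' : (n : ℝ) ≤ N := by exact_mod_cast hnN
  obtain ⟨z, hz⟩ : ∃ z : ℝ, z = 1 / N := ⟨_, rfl⟩
  have hzN : z * N = 1 := by rw [hz]; field_simp
  have hα : (3 : ℝ) / 4 + 1 / (12 * N) = 3 / 4 + z / 12 := by rw [hz]; field_simp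
  have hDz : ((N : ℝ) - n) / (9 * N) = (1 - n * z) / 9 := by rw [hz]; field_simp
  have hz0 : 0 < z := by rw [hz]; positivity
  have hz1 : z ≤ 1 := by nlinarith
  rw [hDz, ← h.sum_eq hm, ← add_sum_erase _ _ (mem_range.2 hk)] at htotal
  have hdef := h.deficient
  rw [hα] at hsmall hdef
  have hrest : ∑ k ∈ (range n).erase k₀,
      (v k + v (2 * n - 1 - k) + ∑ g ∈ Ico (2 * n) m with c g = k, v g) ≤
      ((range n).erase k₀).card • (1 + z / 9) := by
    apply sum_le_card_nsmul
    intro k hk'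
    have hkn := mem_range.1 (mem_of_mem_erase hk')
    rcases h.filled k hkn with h0 | ⟨-, h1⟩
    · rw [h0]; linarith [hle k hkn]
    · rw [hα] at h1; linarith
  rw [card_erase_of_mem (mem_range.2 hk), card_range, nsmul_eq_mul, Nat.cast_sub (by omega),
    Nat.cast_one] at hrest
  nlinarith

lemma sum_le_bundleValue {m : ℕ} {v : ℕ → ℝ} (hv : ∀ g, 0 ≤ v g) {p : ℕ → ℕ} {j : ℕ}
    {s : Finset ℕ} (hs : ∀ g ∈ s, g < m ∧ p g = j) : ∑ g ∈ s, v g ≤ bundleValue m v p j :=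
  sum_le_sum_of_subset_of_nonneg (fun g hg => by simpa using hs g hg) fun g _ _ => hv g

/-- If the goods `L` and `M` together exceed the value of every bundle, then a good up to `L`
never shares its bundle with another good up to `M`. -/
lemma label_ne_label {m : ℕ} {v : ℕ → ℝ} (hv : ∀ g, 0 ≤ v g) (hanti : Antitone v) {p : ℕ → ℕ}
    (hp : ∀ g, bundleValue m v p (p g) ≤ 1) {L M : ℕ} (hL : L < m) (hM : M < m)
    (hLM : 1 < v L + v M) {g g' : ℕ} (hg : g ≤ L) (hg' : g' ≤ M) (hne : g ≠ g') :
    p g ≠ p g' := by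
  intro h
  have h1 : ∑ x ∈ {g, g'}, v x ≤ bundleValue m v p (p g') := by
    apply sum_le_bundleValue hv
    intro x hx
    rcases mem_insert.1 hx with rfl | hx
    · exact ⟨by omega, h⟩
    · rw [mem_singleton.1 hx]
      exact ⟨by omega, rfl⟩
  rw [sum_pair hne] at h1
  linarith [hanti hg', hp g', hanti hg]

/-- Some bundle of a normalized partition contains three of the goods up to `2 * n - 1 - L`. -/
lemma three_mul_le_one {m n : ℕ} {v : ℕ → ℝ} (hv : ∀ g, 0 ≤ v g) (hanti : Antitone v)
    {p : ℕ → ℕ} {J : Finset ℕ} (hJ : J.card = n) (hpJ : ∀ g, p g ∈ J)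
    (hp : ∀ g, bundleValue m v p (p g) ≤ 1) (hm : 2 * n ≤ m) {L : ℕ} (hL : L < n)
    (hLM : 1 < v L + v (2 * n - 1 - L)) : 3 * v (2 * n - 1 - L) ≤ 1 := by
  have hsep := fun g g' => @label_ne_label m v hv hanti p hp L (2 * n - 1 - L) (by omega)
    (by omega) hLM g g'
  have hinj : Set.InjOn p (range (L + 1)) := by
    intro a ha b hb hab
    by_contra hne
    simp only [coe_range, Set.mem_Iio] at ha hb
    exact hsep a b (by omega) (by omega) hne hab
  have hcard : (J \ (range (L + 1)).image p).card = n - (L + 1) := by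
    rw [card_sdiff_of_subset (fun j hj => by
      obtain ⟨g, -, rfl⟩ := mem_image.1 hj; exact hpJ g), card_image_of_injOn hinj, hJ, card_range]
  obtain ⟨j, hj, hfib⟩ := exists_lt_card_fiber_of_mul_lt_card_of_maps_to
    (s := Ico (L + 1) (2 * n - L)) (t := J \ (range (L + 1)).image p) (f := p) (n := 2)
    (fun g hg => by
      rw [mem_Ico] at hg
      refine mem_sdiff.2 ⟨hpJ g, fun hmem => ?_⟩
      obtain ⟨a, ha, hag⟩ := mem_image.1 hmem
      rw [mem_range] at ha
      exact hsep a g (by omega) (by omega) (by omega) hag)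
    (by rw [hcard, Nat.card_Ico]; omega)
  obtain ⟨g₀, hg₀⟩ := card_pos.1 (by omega : 0 < #{g ∈ Ico (L + 1) (2 * n - L) | p g = j})
  have hle : ∑ g ∈ Ico (L + 1) (2 * n - L) with p g = j, v g ≤ 1 := by
    refine (sum_le_bundleValue (m := m) hv (p := p) (j := p g₀) fun g hg => ?_).trans (hp g₀)
    simp only [mem_filter, mem_Ico] at hg hg₀
    exact ⟨by omega, by rw [hg.2, hg₀.2]⟩
  have hge : #{g ∈ Ico (L + 1) (2 * n - L) | p g = j} • v (2 * n - 1 - L) ≤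
      ∑ g ∈ Ico (L + 1) (2 * n - L) with p g = j, v g :=
    card_nsmul_le_sum _ _ _ fun g hg => by
      simp only [mem_filter, mem_Ico] at hg
      exact hanti (by omega)
  have h3 : (3 : ℝ) ≤ #{g ∈ Ico (L + 1) (2 * n - L) | p g = j} := by exact_mod_cast hfib
  rw [nsmul_eq_mul] at hge
  nlinarith [hv (2 * n - 1 - L)]

/-- The bundles containing the goods up to `L` take up many goods of index at least `2 * n - r`,
since they contain few goods of index below that. -/
lemma exists_large_bundle_bounds {m n : ℕ} {v : ℕ → ℝ} (hv : ∀ g, 0 ≤ v g) (hanti : Antitone v)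
    {p : ℕ → ℕ} {J : Finset ℕ} (hJ : J.card = n) (hpJ : ∀ g, p g ∈ J)
    (hp : ∀ g, bundleValue m v p (p g) ≤ 1) (hp' : ∀ j ∈ J, bundleValue m v p j ≤ 1)
    (hm : 2 * n ≤ m) {L r : ℕ} (hL : L < n) (hr : r ≤ L) (hv0 : v 0 ≤ 1)
    (hLM : 1 < v L + v (2 * n - 1 - L)) :
    ∃ q S D : ℝ, r ≤ q ∧ q * (1 - v 0) ≤ S + D ∧ S ≤ ∑ g ∈ Ico (2 * n - r) m, v g ∧
      D ≤ n - ∑ g ∈ range m, v g ∧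
      ∑ g ∈ range (L + 1), v g + ∑ g ∈ Ico (2 * n - 1 - L) (2 * n - r), v g ≤
        (L + 1 : ℕ) - D - S + (q - r) * v (2 * n - 1 - L) := by
  have hsep := fun g g' => @label_ne_label m v hv hanti p hp L (2 * n - 1 - L) (by omega)
    (by omega) hLM g g'
  have hinj : Set.InjOn p (range (L + 1)) := by
    intro a ha b hb hab
    by_contra hne
    simp only [coe_range, Set.mem_Iio] at ha hb
    exact hsep a b (by omega) (by omega) hne hab
  set J₀ := (range (L + 1)).image p with hJ₀
  have hJ₀J : J₀ ⊆ J := fun j hj => by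
    obtain ⟨g, -, rfl⟩ := mem_image.1 hj; exact hpJ g
  have hJ₀card : J₀.card = L + 1 := by rw [hJ₀, card_image_of_injOn hinj, card_range]
  set C := Ico (2 * n - 1 - L) (2 * n - r) with hC
  set Z := Ico (2 * n - r) m with hZ
  have hCcard : C.card = L + 1 - r := by rw [hC, Nat.card_Ico]; omega
  have hsplitC := card_filter_add_card_filter_not (s := C) (fun g => p g ∈ J₀)
  have hvalue : ∑ j ∈ J₀, bundleValue m v p j = ∑ g ∈ range m with p g ∈ J₀, v g :=
    sum_fiberwise_eq_sum_filter (range m) J₀ p v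
  refine ⟨L + 1 - #{g ∈ C | p g ∈ J₀}, ∑ g ∈ Z with p g ∈ J₀, v g,
    (L + 1) - ∑ j ∈ J₀, bundleValue m v p j, ?_, ?_, ?_, ?_, ?_⟩
  · have : r + #{g ∈ C | p g ∈ J₀} ≤ L + 1 := by omega
    have : (r : ℝ) + #{g ∈ C | p g ∈ J₀} ≤ L + 1 := by exact_mod_cast this
    linarith
  · have key : ∀ j ∈ J₀, (1 - (#{g ∈ C | p g = j} : ℝ)) * (1 - v 0) ≤
        ∑ g ∈ Z with p g = j, v g + (1 - bundleValue m v p j) := by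
      intro j hj
      have hZ0 : 0 ≤ ∑ g ∈ Z with p g = j, v g := sum_nonneg fun g _ => hv g
      have hle := hp' j (hJ₀J hj)
      rcases Nat.eq_zero_or_pos #{g ∈ C | p g = j} with h | h
      · obtain ⟨a, ha, haj⟩ := mem_image.1 hj
        have hempty := card_eq_zero.1 h
        have : bundleValue m v p j ≤ v a + ∑ g ∈ Z with p g = j, v g := by
          have hnot : a ∉ ({g ∈ Z | p g = j} : Finset ℕ) := by
            simp only [hZ, mem_filter, mem_Ico, mem_range] at ha ⊢
            omega
          rw [← sum_insert hnot]
          refine sum_le_sum_of_subset_of_nonneg (fun g hg => ?_) fun g _ _ => hv g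
          simp only [mem_filter, mem_range, mem_insert, hZ, mem_Ico] at hg ha ⊢
          by_cases hga : g = a
          · exact Or.inl hga
          · refine Or.inr ⟨⟨?_, hg.1⟩, hg.2⟩
            by_contra hlt
            by_cases hgC : 2 * n - 1 - L ≤ g
            · have : g ∈ ({g ∈ C | p g = j} : Finset ℕ) := by
                simp only [hC, mem_filter, mem_Ico]
                exact ⟨⟨hgC, by omega⟩, hg.2⟩
              simp [hempty] at this
            · exact hsep a g (by omega) (by omega) (Ne.symm hga) (haj.trans hg.2.symm)
        rw [h]
        have := hanti (Nat.zero_le a)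
        push_cast
        linarith
      · have : (1 : ℝ) ≤ #{g ∈ C | p g = j} := by exact_mod_cast h
        nlinarith
    have hsum := sum_le_sum key
    rw [← sum_mul, sum_sub_distrib, sum_add_distrib, sum_sub_distrib, sum_const, hJ₀card] at hsum
    have hcount : ∑ j ∈ J₀, (#{g ∈ C | p g = j} : ℝ) = #{g ∈ C | p g ∈ J₀} := by
      simpa using sum_fiberwise_eq_sum_filter C J₀ p fun _ => (1 : ℝ)
    have hZsum := sum_fiberwise_eq_sum_filter Z J₀ p v
    rw [hcount, hZsum] at hsum
    simp only [nsmul_eq_mul, mul_one, Nat.cast_add, Nat.cast_one] at hsum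
    linarith
  · exact sum_le_sum_of_subset_of_nonneg (filter_subset _ _) fun g _ _ => hv g
  · have htot : ∑ j ∈ J, bundleValue m v p j = ∑ g ∈ range m, v g :=
      sum_fiberwise_of_maps_to (fun g _ => hpJ g) _
    have hrest : ∑ j ∈ J \ J₀, bundleValue m v p j ≤ (J \ J₀).card • (1 : ℝ) :=
      sum_le_card_nsmul _ _ _ fun j hj => hp' j (mem_sdiff.1 hj).1
    rw [card_sdiff_of_subset hJ₀J, hJ, hJ₀card, nsmul_eq_mul, Nat.cast_sub (by omega)] at hrest
    have := sum_sdiff hJ₀J (f := bundleValue m v p)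
    push_cast at hrest
    linarith
  · have hA : ∀ g ∈ range (L + 1), p g ∈ J₀ := fun g hg => mem_image_of_mem p hg
    have hdisj : ∑ g ∈ range (L + 1), v g + ∑ g ∈ C with p g ∈ J₀, v g +
        ∑ g ∈ Z with p g ∈ J₀, v g ≤ ∑ g ∈ range m with p g ∈ J₀, v g := by
      rw [← sum_union, ← sum_union]
      · refine sum_le_sum_of_subset_of_nonneg (fun g hg => ?_) fun g _ _ => hv g
        simp only [mem_union, mem_filter, hC, hZ, mem_Ico] at hg ⊢
        rcases hg with (hg | hg) | hg
        · exact ⟨mem_range.2 (by have := mem_range.1 hg; omega), hA g hg⟩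
        · exact ⟨mem_range.2 (by omega), hg.2⟩
        · exact ⟨mem_range.2 (by omega), hg.2⟩
      · rw [disjoint_left]
        intro g hg hg'
        simp only [mem_union, mem_filter, hC, hZ, mem_Ico, mem_range] at hg hg'
        omega
      · rw [disjoint_left]
        intro g hg hg'
        simp only [mem_filter, hC, mem_Ico, mem_range] at hg hg'
        omega
    have hCnot : ∑ g ∈ C with ¬ p g ∈ J₀, v g ≤ #{g ∈ C | ¬ p g ∈ J₀} • v (2 * n - 1 - L) :=
      sum_le_card_nsmul _ _ _ fun g hg => by
        simp only [mem_filter, hC, mem_Ico] at hg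
        exact hanti hg.1.1
    have hCsplit := sum_filter_add_sum_filter_not C (fun g => p g ∈ J₀) v
    have hcast : (#{g ∈ C | ¬ p g ∈ J₀} : ℝ) = L + 1 - #{g ∈ C | p g ∈ J₀} - r := by
      have : #{g ∈ C | p g ∈ J₀} + #{g ∈ C | ¬ p g ∈ J₀} + r = L + 1 := by omega
      have : (#{g ∈ C | p g ∈ J₀} + #{g ∈ C | ¬ p g ∈ J₀} + r : ℝ) = L + 1 := by
        exact_mod_cast this
      linarith
    rw [nsmul_eq_mul, hcast] at hCnot
    rw [hvalue]
    push_cast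
    linarith

/-- A stuck agent with a normalized partition of large total value cannot value the goods `0` and
`2 * n` as little as the reductions guarantee. -/
theorem not_isStuck {m n N : ℕ} {v : ℕ → ℝ} (hv : ∀ g, 0 ≤ v g) (hanti : Antitone v)
    (hm : 2 * n ≤ m) (hnN : n ≤ N)
    (hpart : HasNormalizedPartition m v n (n - (N - n) / (9 * N)))
    (h0 : v 0 < 3 / 4 + 1 / (12 * N)) (hsmall : 3 * v (2 * n) ≤ 3 / 4 + 1 / (12 * N))
    (h02 : v 0 + v (2 * n) ≤ 3 / 4 + 1 / (12 * N)) {c : ℕ → ℕ} {k₀ : ℕ} :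
    ¬ IsStuck m n (3 / 4 + 1 / (12 * N)) v c k₀ := by
  intro h
  obtain ⟨p, J, hJ, hpJ, hp', htotal⟩ := hpart
  have hp := fun g => hp' (p g) (hpJ g)
  obtain ⟨k₁, hk₁, hβ₁⟩ := h.exists_one_lt hm hnN hsmall htotal
  obtain ⟨L, hLmem, hLmax⟩ := exists_max_image {k ∈ range n | 1 < v k + v (2 * n - 1 - k)} id
    ⟨k₁, by simp [hk₁, hβ₁]⟩
  simp only [mem_filter, mem_range, id] at hLmem hLmax
  obtain ⟨hLn, hLM⟩ := hLmem
  have hle1 : ∀ k < n, L < k → v k + v (2 * n - 1 - k) ≤ 1 := fun k hk hLk => by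
    by_contra! hlt
    have := hLmax k ⟨hk, hlt⟩
    omega
  have hN : (1 : ℝ) ≤ N := by exact_mod_cast (by omega : 1 ≤ N)
  have hx := three_mul_le_one hv hanti hJ hpJ hp hm hLn hLM
  obtain ⟨γ, hγ⟩ : ∃ γ : ℝ, γ = 1 / 4 - 1 / (12 * N) := ⟨_, rfl⟩
  have hγ0 : 1 / 6 ≤ γ := by
    have : (1 : ℝ) / (12 * N) ≤ 1 / 12 := by
      apply one_div_le_one_div_of_le <;> linarith
    linarith
  have hα : (3 : ℝ) / 4 + 1 / (12 * N) = 1 - γ := by rw [hγ]; ring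
  rw [hα] at h h0 hsmall h02
  set x := v (2 * n - 1 - L) with hxdef
  set fill : ℕ → ℝ := fun k => ∑ g ∈ Ico (2 * n) m with c g = k, v g with hfill
  have hfill0 : ∀ k, 0 ≤ fill k := fun k => sum_nonneg fun g _ => hv g
  have hdef : v k₀ + v (2 * n - 1 - k₀) + fill k₀ < 1 - γ := h.deficient
  have hfilled : ∀ k < n, fill k = 0 ∨ (v k + v (2 * n - 1 - k) < 1 - γ ∧
      v k + v (2 * n - 1 - k) + fill k < 1 - γ + v (2 * n)) := h.filled
  have hk₀ := h.lt
  have hvL : v L ≤ v 0 := hanti (Nat.zero_le L)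
  have htouched : ∀ k < n, k = k₀ ∨ fill k ≠ 0 → v k + v (2 * n - 1 - k) < 1 - γ ∧
      v k + v (2 * n - 1 - k) + fill k < 4 / 3 - 2 * γ := by
    rintro k hk (rfl | hk')
    · constructor <;> linarith [hfill0 k, hv (2 * n)]
    · rcases hfilled k hk with h1 | ⟨h1, h2⟩
      · exact absurd h1 hk'
      · exact ⟨h1, by linarith⟩
  have hLuntouched : ¬ (L = k₀ ∨ fill L ≠ 0) := fun hL => by
    have := (htouched L hLn hL).1
    linarith
  classical
  have hex : ∃ r, ∀ k, r ≤ k → k ≤ L → ¬ (k = k₀ ∨ fill k ≠ 0) :=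
    ⟨L, fun k h1 h2 => by rwa [le_antisymm h2 h1]⟩
  obtain ⟨r, hrspec, hrmin⟩ : ∃ r, (∀ k, r ≤ k → k ≤ L → ¬ (k = k₀ ∨ fill k ≠ 0)) ∧
      ∀ s < r, ¬ ∀ k, s ≤ k → k ≤ L → ¬ (k = k₀ ∨ fill k ≠ 0) :=
    ⟨Nat.find hex, Nat.find_spec hex, fun s hs => Nat.find_min hex hs⟩
  have hrL : r ≤ L := by
    by_contra! hlt
    exact hrmin L hlt fun k h1 h2 => by rwa [le_antisymm h2 h1]
  have hpartner : ∀ k < r, v (2 * n - 1 - k) ≤ 1 - γ - v L := by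
    intro k hk
    have := hrmin (r - 1) (by omega)
    push Not at this
    obtain ⟨k', h1, h2, h3⟩ := this
    have hk' : k' = r - 1 := by
      by_contra hne
      exact hrspec k' (by omega) h2 (by tauto)
    have h4 := (htouched k' (by omega) (by tauto)).1
    have h5 : v (2 * n - 1 - k) ≤ v (2 * n - 1 - k') := hanti (by omega)
    have h6 : v L ≤ v k' := hanti h2
    linarith
  have hbelow : ∀ k < r, v k + v (2 * n - 1 - k) + fill k ≤ 4 / 3 - 2 * γ := by
    intro k hk
    by_cases hk' : k = k₀ ∨ fill k ≠ 0
    · exact (htouched k (by omega) hk').2.le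
    · push Not at hk'
      have := hanti (Nat.zero_le k)
      linarith [hpartner k hk]
  obtain ⟨q, S, D, hrq, hqS, hSΦ, hD, hsum⟩ :=
    exists_large_bundle_bounds hv hanti hJ hpJ hp hp' hm hLn hrL (by linarith) hLM
  rw [← hxdef] at hsum
  have hr0 : (0 : ℝ) ≤ r := Nat.cast_nonneg r
  set W := {k ∈ range n | k ≠ k₀ ∧ (k < r ∨ (L < k ∧ fill k ≠ 0))} with hW
  have hWcard : W.card + 2 ≤ n := by
    have hne : L ≠ k₀ := fun h => hLuntouched (Or.inl h)
    have hsub : W ⊆ ((range n).erase k₀).erase L := by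
      intro k hk
      simp only [hW, mem_filter, mem_range, mem_erase] at hk ⊢
      omega
    have := card_le_card hsub
    rw [card_erase_of_mem (by simp [hne, hLn]), card_erase_of_mem (by simp [hk₀]),
      card_range] at this
    omega
  have hWsum : ∀ a : ℝ, ∑ k ∈ range n, (if k ∈ W then a else 0) = W.card * a := by
    intro a
    rw [← sum_filter, sum_const, nsmul_eq_mul]
    congr 3
    ext k
    simp only [hW, mem_filter]
    tauto
  have hk₀sum : ∀ a : ℝ, ∑ k ∈ range n, (if k = k₀ then a else 0) = a := by
    intro a
    rw [sum_ite_eq' (range n) k₀ (fun _ => a), if_pos (mem_range.2 hk₀)]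
  have hΦ : ∑ g ∈ Ico (2 * n - r) m, v g ≤
      W.card * (4 / 3 - 2 * γ - 2 * x) + (1 - γ - 2 * x) := by
    have hsplit : ∑ g ∈ Ico (2 * n - r) m, v g =
        ∑ k ∈ range n, ((if k < r then v (2 * n - 1 - k) else 0) + fill k) := by
      rw [sum_add_distrib, ← sum_filter, hfill, sum_fiberwise_of_maps_to h.maps,
        ← sum_Ico_consecutive v (by omega : 2 * n - r ≤ 2 * n) hm]
      congr 1
      have := sum_pairs v (n := n) (a := 0) (b := r) (by omega) (by omega)
      rw [Nat.sub_zero] at this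
      rw [← this]
      refine sum_congr ?_ fun _ _ => rfl
      ext k
      simp only [mem_filter, mem_range, mem_Ico]
      omega
    rw [hsplit, ← hWsum, ← hk₀sum (1 - γ - 2 * x), ← sum_add_distrib]
    refine sum_le_sum fun k hk => ?_
    rw [mem_range] at hk
    rcases lt_or_ge k r with hkr | hkr
    · have h1 : v L ≤ v k := hanti (by omega)
      rw [if_pos hkr]
      by_cases hkk : k = k₀
      · subst hkk
        rw [if_neg (by simp [hW]), if_pos rfl]
        linarith
      · rw [if_pos (by simp [hW, hk, hkk, hkr]), if_neg hkk]
        linarith [hbelow k hkr]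
    · rw [if_neg (by omega)]
      rcases le_or_gt k L with hkL | hkL
      · have h1 := hrspec k hkr hkL
        push Not at h1
        rw [h1.2, if_neg (by simp only [hW, mem_filter]; omega), if_neg h1.1]
      · have h1 : x ≤ v k := hanti (by omega)
        have h2 : x ≤ v (2 * n - 1 - k) := hanti (by omega)
        by_cases hkk : k = k₀
        · subst hkk
          rw [if_neg (by simp [hW]), if_pos rfl]
          linarith
        · rw [if_neg hkk]
          by_cases hk' : fill k = 0
          · rw [hk', if_neg (by simp [hW, hk', not_lt.2 hkr])]
          · rw [if_pos (by simp [hW, hk, hkk, hkL, hk'])]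
            linarith [(htouched k hk (Or.inr hk')).2]
  have htot : ∑ g ∈ range m, v g ≤ ∑ k ∈ Ico r (L + 1), (v k + v (2 * n - 1 - k) - 1) + n -
      W.card * (2 * γ - 1 / 3) - γ := by
    have hIco : ∑ k ∈ Ico r (L + 1), (v k + v (2 * n - 1 - k) - 1) =
        ∑ k ∈ range n, if r ≤ k ∧ k ≤ L then v k + v (2 * n - 1 - k) - 1 else 0 := by
      rw [← sum_filter]
      refine sum_congr ?_ fun _ _ => rfl
      ext k
      simp only [mem_filter, mem_range, mem_Ico]
      omega
    have hsplit : ∑ k ∈ Ico r (L + 1), (v k + v (2 * n - 1 - k) - 1) + n -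
        W.card * (2 * γ - 1 / 3) - γ = ∑ k ∈ range n,
          ((if r ≤ k ∧ k ≤ L then v k + v (2 * n - 1 - k) - 1 else 0) + 1 -
            (if k ∈ W then 2 * γ - 1 / 3 else 0) - if k = k₀ then γ else 0) := by
      rw [hIco, sum_sub_distrib, sum_sub_distrib, sum_add_distrib, hWsum, hk₀sum]
      simp
    rw [← h.sum_eq hm, hsplit]
    refine sum_le_sum fun k hk => ?_
    change v k + v (2 * n - 1 - k) + fill k ≤ _
    rw [mem_range] at hk
    by_cases hkk : k = k₀
    · subst hkk
      rw [if_neg (fun h1 => hrspec k h1.1 h1.2 (Or.inl rfl)), if_neg (by simp [hW]), if_pos rfl]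
      linarith
    rw [if_neg hkk]
    rcases lt_or_ge k r with hkr | hkr
    · rw [if_neg (by omega), if_pos (by simp [hW, hk, hkk, hkr])]
      linarith [hbelow k hkr]
    rcases le_or_gt k L with hkL | hkL
    · have h1 := hrspec k hkr hkL
      push Not at h1
      rw [h1.2, if_pos ⟨hkr, hkL⟩, if_neg (by simp only [hW, mem_filter]; omega)]
      linarith
    · rw [if_neg (by omega)]
      by_cases hk' : fill k = 0
      · rw [hk', if_neg (by simp [hW, hk', not_lt.2 hkr])]
        linarith [hle1 k hk hkL]
      · rw [if_pos (by simp [hW, hk, hkk, hkL, hk'])]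
        linarith [(htouched k hk (Or.inr hk')).2]
  have hmiddle : ∑ k ∈ Ico r (L + 1), (v k + v (2 * n - 1 - k) - 1) ≤ q * x - D - S := by
    have h1 := sum_range_add_sum_Ico v (by omega : r ≤ L + 1)
    have h2 : r • v L ≤ ∑ k ∈ range r, v k := by
      have := card_nsmul_le_sum (range r) v (v L) fun k hk =>
        hanti (by have := mem_range.1 hk; omega)
      rwa [card_range] at this
    rw [sum_sub_distrib, sum_add_distrib, sum_pairs v (by omega) (by omega), sum_const,
      Nat.card_Ico, nsmul_eq_mul, Nat.cast_sub (by omega),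
      show 2 * n - (L + 1) = 2 * n - 1 - L by omega]
    rw [nsmul_eq_mul] at h2
    nlinarith
  refine stuck_numeric hWcard hnN hγ hx (by linarith) (q := q) (S := S) (D := D) ?_ hSΦ
    (by linarith) hΦ (by linarith)
  nlinarith

/-- Bag filling. The bags `k ∈ K` start with the value `β i k` for agent `i` and are filled one
after the other with goods of `F`. Either every agent gets a bag of value at least `α`, or some
agent is left when a bag cannot be completed. -/
lemma exists_bag_filling {ι : Type*} [DecidableEq ι] [Nonempty ι] {α : ℝ} {v : ι → ℕ → ℝ}
    (hv : ∀ i g, 0 ≤ v i g) (β : ι → ℕ → ℝ) (s : ι → ℝ) (S : Finset ι) :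
    ∀ K F : Finset ℕ, S.card = K.card → (∀ i ∈ S, ∀ g ∈ F, v i g ≤ s i) →
    (∃ (c : ℕ → ℕ) (f : ℕ → ι), ∀ i ∈ S, ∃ k ∈ K, f k = i ∧
      α ≤ β i k + ∑ g ∈ F with c g = k, v i g) ∨
    (∃ i ∈ S, ∃ c : ℕ → ℕ, (∀ g ∈ F, c g ∈ K) ∧
      (∃ k ∈ K, β i k + ∑ g ∈ F with c g = k, v i g < α) ∧
      ∀ k ∈ K, (∑ g ∈ F with c g = k, v i g) = 0 ∨
        (β i k < α ∧ β i k + ∑ g ∈ F with c g = k, v i g < α + s i)) := by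
  induction S using Finset.strongInduction with
  | H S ih =>
    intro K F hcard hs
    rcases S.eq_empty_or_nonempty with rfl | ⟨i₀, hi₀⟩
    · exact Or.inl ⟨id, fun _ => Classical.arbitrary ι, by simp⟩
    obtain ⟨k, hk⟩ : K.Nonempty := card_pos.1 (hcard ▸ card_pos.2 ⟨i₀, hi₀⟩)
    by_cases hex : ∃ T ∈ F.powerset, ∃ i ∈ S, α ≤ β i k + ∑ g ∈ T, v i g
    · classical
      obtain ⟨T₁, hT₁, hT₁'⟩ := hex
      obtain ⟨T, hT, hTmin⟩ := exists_min_image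
        {T ∈ F.powerset | ∃ i ∈ S, α ≤ β i k + ∑ g ∈ T, v i g} card
        ⟨T₁, mem_filter.2 ⟨hT₁, hT₁'⟩⟩
      simp only [mem_filter, mem_powerset] at hT hTmin
      obtain ⟨hTF, i, hi, hiT⟩ := hT
      have hsmaller : ∀ T' ⊆ F, T'.card < T.card → ∀ i ∈ S, β i k + ∑ g ∈ T', v i g < α := by
        intro T' hT' hlt i hi
        by_contra! hle
        exact absurd (hTmin T' ⟨hT', i, hi, hle⟩) (by omega)
      rcases ih (S.erase i) (erase_ssubset hi) (K.erase k) (F \ T)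
        (by rw [card_erase_of_mem hi, card_erase_of_mem hk, hcard])
        (fun i' hi' g hg => hs i' (mem_of_mem_erase hi') g (mem_sdiff.1 hg).1) with
        ⟨c, f, hcf⟩ | ⟨i', hi', c, hc, ⟨k', hk', hlt⟩, hother⟩
      · refine Or.inl ⟨fun g => if g ∈ T then k else c g, fun k' => if k' = k then i else f k',
          fun i' hi' => ?_⟩
        by_cases hii : i' = i
        · subst hii
          refine ⟨k, hk, by simp, hiT.trans ?_⟩
          gcongr
          · intro g _ _
            exact hv i' g
          · intro g hg
            simp [hg, hTF hg]
        · obtain ⟨k', hk', hf, hle⟩ := hcf i' (mem_erase.2 ⟨hii, hi'⟩)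
          refine ⟨k', mem_of_mem_erase hk', by simp [ne_of_mem_erase hk', hf], hle.trans ?_⟩
          gcongr
          · intro g _ _
            exact hv i' g
          · intro g hg
            simp only [mem_filter, mem_sdiff] at hg ⊢
            exact ⟨hg.1.1, by rw [if_neg hg.1.2, hg.2]⟩
      · have hnew : ({g ∈ F | (if g ∈ T then k else c g) = k} : Finset ℕ) = T := by
          ext g
          simp only [mem_filter]
          constructor
          · rintro ⟨hgF, hg⟩
            by_contra hgT
            rw [if_neg hgT] at hg
            exact ne_of_mem_erase (hc g (mem_sdiff.2 ⟨hgF, hgT⟩)) hg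
          · exact fun hg => ⟨hTF hg, if_pos hg⟩
        have hold : ∀ k' ∈ K.erase k, ({g ∈ F | (if g ∈ T then k else c g) = k'} : Finset ℕ) =
            {g ∈ F \ T | c g = k'} := by
          intro k' hk'
          ext g
          simp only [mem_filter, mem_sdiff]
          by_cases hgT : g ∈ T
          · simp [hgT, (ne_of_mem_erase hk').symm]
          · simp [hgT]
        refine Or.inr ⟨i', mem_of_mem_erase hi', fun g => if g ∈ T then k else c g, ?_,
          ⟨k', mem_of_mem_erase hk', by rwa [hold k' hk']⟩, fun k'' hk'' => ?_⟩
        · intro g hg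
          by_cases hgT : g ∈ T
          · simpa [hgT] using hk
          · simpa [hgT] using mem_of_mem_erase (hc g (mem_sdiff.2 ⟨hg, hgT⟩))
        · by_cases hkk : k'' = k
          · subst hkk
            rw [hnew]
            rcases T.eq_empty_or_nonempty with rfl | ⟨g, hg⟩
            · exact Or.inl sum_empty
            · have hi'S := mem_of_mem_erase hi'
              have h1 := hsmaller ∅ (empty_subset F) (card_pos.2 ⟨g, hg⟩) i' hi'S
              have h2 := hsmaller (T.erase g) ((erase_subset g T).trans hTF)
                (card_erase_lt_of_mem hg) i' hi'S
              rw [sum_empty, add_zero] at h1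
              refine Or.inr ⟨h1, ?_⟩
              rw [← add_sum_erase T _ hg]
              linarith [hs i' hi'S g (hTF hg)]
          · have hk''e := mem_erase.2 ⟨hkk, hk''⟩
            rw [hold k'' hk''e]
            exact hother k'' hk''e
    · push Not at hex
      refine Or.inr ⟨i₀, hi₀, fun _ => k, fun _ _ => hk, ⟨k, hk, ?_⟩, fun k' hk' => ?_⟩
      · simpa using hex F (mem_powerset_self F) i₀ hi₀
      · by_cases hkk : k = k'
        · subst hkk
          by_cases hF : (∑ g ∈ F with k = k, v i₀ g) = 0
          · exact Or.inl hF
          · have h1 := hex ∅ (empty_mem_powerset F) i₀ hi₀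
            have h2 := hex F (mem_powerset_self F) i₀ hi₀
            obtain ⟨g, hg⟩ : F.Nonempty := by
              by_contra hne
              simp [not_nonempty_iff_eq_empty.1 hne] at hF
            rw [sum_empty, add_zero] at h1
            refine Or.inr ⟨h1, ?_⟩
            simp only [filter_true]
            linarith [hs i₀ hi₀ g hg, hv i₀ g]
        · exact Or.inl (by simp [hkk])

/-- Capping the bundle values by rescaling the goods. -/
lemma HasCappedPartition.exists_normalized {m n : ℕ} {v : ℕ → ℝ} {c : ℝ}
    (h : HasCappedPartition m v n c) (hn : 1 ≤ n) (hv : ∀ g, 0 ≤ v g) :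
    ∃ w : ℕ → ℝ, (∀ g, 0 ≤ w g) ∧ (∀ g, w g ≤ v g) ∧ (∀ g, m ≤ g → w g = 0) ∧
      HasNormalizedPartition m w n c := by
  obtain ⟨p, J, hJ, hc⟩ := h
  obtain ⟨j₀, hj₀⟩ : J.Nonempty := card_pos.1 (by omega)
  set w : ℕ → ℝ := fun g =>
    if g < m ∧ p g ∈ J then v g / max 1 (bundleValue m v p (p g)) else 0 with hw
  set p' : ℕ → ℕ := fun g => if p g ∈ J then p g else j₀ with hp'
  have hpJ : ∀ g, p' g ∈ J := fun g => by
    by_cases hg : p g ∈ J <;> simp [hp', hg, hj₀]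
  have hvalue : ∀ j ∈ J, bundleValue m w p' j = min 1 (bundleValue m v p j) := by
    intro j hj
    have hpos : 0 < max 1 (bundleValue m v p j) := lt_max_of_lt_left one_pos
    have h1 : bundleValue m w p' j = bundleValue m v p j / max 1 (bundleValue m v p j) := by
      conv_rhs => rw [bundleValue, sum_div]
      rw [bundleValue, sum_filter, sum_filter]
      refine sum_congr rfl fun g hg => ?_
      rw [mem_range] at hg
      by_cases hgJ : p g ∈ J
      · have hgj : p' g = p g := if_pos hgJ
        rw [hgj]
        by_cases hpg : p g = j
        · simp [hpg, hw, hg, hj, bundleValue]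
        · simp [hpg]
      · have : p g ≠ j := fun hpg => hgJ (hpg ▸ hj)
        simp [hw, hgJ, this]
    rw [h1]
    rcases le_total 1 (bundleValue m v p j) with h2 | h2
    · rw [max_eq_right h2, min_eq_left h2, div_self (by linarith)]
    · rw [max_eq_left h2, min_eq_right h2, div_one]
  refine ⟨w, fun g => ?_, fun g => ?_, fun g hg => ?_, p', J, hJ, hpJ, fun j hj => ?_, ?_⟩
  · by_cases hg : g < m ∧ p g ∈ J
    · simp only [hw, if_pos hg]
      exact div_nonneg (hv g) (le_max_of_le_left zero_le_one)
    · simp only [hw, if_neg hg, le_refl]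
  · by_cases hg : g < m ∧ p g ∈ J
    · simp only [hw, if_pos hg]
      exact div_le_self (hv g) (le_max_left _ _)
    · simp only [hw, if_neg hg, hv g]
  · simp [hw, Nat.not_lt.2 hg]
  · rw [hvalue j hj]
    exact min_le_left _ _
  · rw [← sum_congr rfl hvalue] at hc
    rw [← sum_fiberwise_of_maps_to (g := p') (t := J) (fun g _ => hpJ g)]
    exact hc

lemma HasNormalizedPartition.comp_perm {m n : ℕ} {v : ℕ → ℝ} {c : ℝ}
    (h : HasNormalizedPartition m v n c) (σ : Equiv.Perm ℕ) (hσ : ∀ g, σ g < m ↔ g < m) :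
    HasNormalizedPartition m (v ∘ σ) n c := by
  obtain ⟨p, J, hJ, hpJ, hp, hc⟩ := h
  refine ⟨p ∘ σ, J, hJ, fun g => hpJ _, fun j hj => ?_, ?_⟩
  · rw [bundleValue, sum_equiv σ (t := {g ∈ range m | p g = j}) (g := v)
      (by simp [hσ]) (by simp)]
    exact hp j hj
  · rw [sum_equiv σ (t := range m) (g := v) (by simp [hσ]) (by simp)]
    exact hc

lemma exists_perm_antitone {m : ℕ} {v : ℕ → ℝ} (hv : ∀ g, 0 ≤ v g)
    (hzero : ∀ g, m ≤ g → v g = 0) :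
    ∃ σ : Equiv.Perm ℕ, (∀ g, σ g < m ↔ g < m) ∧ Antitone (v ∘ σ) := by
  set τ := Tuple.sort fun i : Fin m => - v i with hτ
  set σ := τ.extendDomain (Fin.equivSubtype (n := m)) with hσ
  have hin : ∀ g (hg : g < m), σ g = τ ⟨g, hg⟩ := fun g hg => by
    have := Equiv.Perm.extendDomain_apply_image τ (Fin.equivSubtype (n := m)) ⟨g, hg⟩
    simpa using this
  have hout : ∀ g, ¬ g < m → σ g = g := fun g hg =>
    Equiv.Perm.extendDomain_apply_not_subtype _ _ hg
  refine ⟨σ, fun g => ?_, fun a b hab => ?_⟩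
  · by_cases hg : g < m
    · simp [hin g hg, hg]
    · simp [hout g hg, hg]
  · simp only [Function.comp]
    by_cases hb : b < m
    · have := Tuple.monotone_sort (fun i : Fin m => - v i)
        (show (⟨a, by omega⟩ : Fin m) ≤ ⟨b, hb⟩ from hab)
      rw [hin a (by omega), hin b hb]
      simpa using this
    · rw [hout b hb, hzero b (by omega)]
      exact hv _

/-- Picking in the order of the goods turns an allocation of the sorted instance into one of the
original instance. -/
lemma exists_picking {ι : Type*} [DecidableEq ι] [Nonempty ι] {m : ℕ} {v : ι → ℕ → ℝ}
    (hv : ∀ i g, 0 ≤ v i g) (σ : ι → Equiv.Perm ℕ) (hσ : ∀ i g, σ i g < m ↔ g < m)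
    (hanti : ∀ i, Antitone (v i ∘ σ i)) (a : ℕ → ι) :
    ∃ b : ℕ → ι, ∀ i, ∑ g ∈ range m with a g = i, v i (σ i g) ≤
      ∑ g ∈ range m with b g = i, v i g := by
  obtain ⟨f, hf, hmem⟩ := (all_card_le_biUnion_card_iff_exists_injective
    fun k : ℕ => (range (k + 1)).image (σ (a k))).1 (by
      intro s
      rcases s.eq_empty_or_nonempty with rfl | hs
      · simp
      · have h1 : s.card ≤ s.max' hs + 1 := by
          have hsub : s ⊆ range (s.max' hs + 1) := fun k hk =>
            mem_range.2 (Nat.lt_succ_of_le (s.le_max' k hk))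
          simpa using card_le_card hsub
        have h2 := card_le_card (subset_biUnion_of_mem
          (fun k : ℕ => (range (k + 1)).image (σ (a k))) (s.max'_mem hs))
        rw [card_image_of_injective _ (σ _).injective, card_range] at h2
        exact h1.trans h2)
  refine ⟨Function.extend f a fun _ => Classical.arbitrary ι, fun i => ?_⟩
  calc ∑ g ∈ range m with a g = i, v i (σ i g) ≤ ∑ g ∈ range m with a g = i, v i (f g) := by
        refine sum_le_sum fun g hg => ?_
        obtain ⟨l, hl, hlf⟩ := mem_image.1 (hmem g)
        rw [← hlf, (mem_filter.1 hg).2]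
        exact hanti i (by have := mem_range.1 hl; omega)
    _ = ∑ g ∈ ({g ∈ range m | a g = i} : Finset ℕ).image f, v i g :=
        (sum_image fun _ _ _ _ h => hf h).symm
    _ ≤ _ := by
        refine sum_le_sum_of_subset_of_nonneg (fun g hg => ?_) fun g _ _ => hv i g
        obtain ⟨k, hk, rfl⟩ := mem_image.1 hg
        simp only [mem_filter, mem_range] at hk ⊢
        refine ⟨?_, by rw [hf.extend_apply, hk.2]⟩
        obtain ⟨l, hl, hlf⟩ := mem_image.1 (hmem k)
        rw [← hlf, hσ]
        have := mem_range.1 hl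
        omega

/-- The valuation `v` after the goods of `R` have been removed. -/
def removeGoods (R : Finset ℕ) (v : ℕ → ℝ) (g : ℕ) : ℝ :=
  if g ∈ R then 0 else v g

lemma removeGoods_nonneg (R : Finset ℕ) {v : ℕ → ℝ} (hv : ∀ g, 0 ≤ v g) (g : ℕ) :
    0 ≤ removeGoods R v g := by
  unfold removeGoods
  split_ifs
  exacts [le_rfl, hv g]

lemma bundleValue_removeGoods_of_forall_ne {m : ℕ} {v : ℕ → ℝ} {p : ℕ → ℕ} {j : ℕ} {R : Finset ℕ}
    (hR : ∀ g ∈ R, p g ≠ j) : bundleValue m (removeGoods R v) p j = bundleValue m v p j :=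
  sum_congr rfl fun g hg => if_neg fun hgR => hR g hgR (mem_filter.1 hg).2

lemma bundleValue_le_bundleValue_removeGoods {m : ℕ} {v : ℕ → ℝ} (hv : ∀ g, 0 ≤ v g) (p : ℕ → ℕ)
    (j : ℕ) (R : Finset ℕ) :
    bundleValue m v p j ≤ bundleValue m (removeGoods R v) p j + ∑ g ∈ R, v g := by
  have h : bundleValue m v p j = bundleValue m (removeGoods R v) p j +
      ∑ g ∈ {g ∈ range m | p g = j} with g ∈ R, v g := by
    rw [sum_filter _ v, bundleValue, bundleValue, ← sum_add_distrib]
    refine sum_congr rfl fun g _ => ?_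
    unfold removeGoods
    split_ifs <;> simp
  rw [h]
  gcongr
  · intro g _ _
    exact hv g
  · exact fun g hg => (mem_filter.1 hg).2

lemma HasCappedPartition.of_labels {m : ℕ} {v : ℕ → ℝ} {p : ℕ → ℕ} {J : Finset ℕ} {c : ℝ}
    {R : Finset ℕ} (hc : c ≤ ∑ j ∈ J, min 1 (bundleValue m v p j)) (hR : ∀ g ∈ R, p g ∉ J) :
    HasCappedPartition m (removeGoods R v) J.card c := by
  refine ⟨p, J, rfl, hc.trans_eq (sum_congr rfl fun j hj => ?_)⟩
  rw [bundleValue_removeGoods_of_forall_ne]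
  rintro g hg rfl
  exact hR g hg hj

lemma sum_min_bundleValue {m : ℕ} {v : ℕ → ℝ} {p : ℕ → ℕ} {J : Finset ℕ}
    (hpJ : ∀ g, p g ∈ J) (hp : ∀ j ∈ J, bundleValue m v p j ≤ 1) :
    ∑ j ∈ J, min 1 (bundleValue m v p j) = ∑ g ∈ range m, v g := by
  rw [← sum_fiberwise_of_maps_to (s := range m) (g := p) (t := J) (fun g _ => hpJ g)]
  exact sum_congr rfl fun j hj => min_eq_right (hp j hj)

lemma le_sum_erase_min_bundleValue {m : ℕ} {v : ℕ → ℝ} {p : ℕ → ℕ} {J : Finset ℕ} {c : ℝ}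
    (hpJ : ∀ g, p g ∈ J) (hp : ∀ j ∈ J, bundleValue m v p j ≤ 1) (hc : c ≤ ∑ g ∈ range m, v g)
    {j₀ : ℕ} (hj₀ : j₀ ∈ J) : c - 1 ≤ ∑ j ∈ J.erase j₀, min 1 (bundleValue m v p j) := by
  have h := add_sum_erase J (fun j => min 1 (bundleValue m v p j)) hj₀
  rw [sum_min_bundleValue hpJ hp] at h
  have := min_le_left 1 (bundleValue m v p j₀)
  linarith

lemma HasNormalizedPartition.remove_one {m n : ℕ} {v : ℕ → ℝ} {c : ℝ}
    (h : HasNormalizedPartition m v n c) (a : ℕ) :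
    HasCappedPartition m (removeGoods {a} v) (n - 1) (c - 1) := by
  obtain ⟨p, J, hJ, hpJ, hp, hc⟩ := h
  rw [← hJ, ← card_erase_of_mem (hpJ a)]
  exact .of_labels (le_sum_erase_min_bundleValue hpJ hp hc (hpJ a)) (by simp)

lemma HasNormalizedPartition.remove_two {m n : ℕ} {v : ℕ → ℝ} {c : ℝ}
    (h : HasNormalizedPartition m v n c) (hv : ∀ g, 0 ≤ v g) {a b : ℕ} (hab : a ≠ b) {η : ℝ}
    (hη : 0 ≤ η) (hvab : v a + v b ≤ 1 + η) :
    HasCappedPartition m (removeGoods {a, b} v) (n - 1) (c - 1 - η) := by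
  obtain ⟨p, J, hJ, hpJ, hp, hc⟩ := h
  rw [← hJ, ← card_erase_of_mem (hpJ a)]
  by_cases hpab : p b = p a
  · refine .of_labels ((sub_le_self _ hη).trans
      (le_sum_erase_min_bundleValue hpJ hp hc (hpJ a))) (by simp [hpab])
  · have hb : p b ∈ J.erase (p a) := mem_erase.2 ⟨hpab, hpJ b⟩
    set p' : ℕ → ℕ := fun g => if p g = p a then p b else p g with hp'
    refine ⟨p', J.erase (p a), rfl, ?_⟩
    have hother : ∀ j ∈ (J.erase (p a)).erase (p b),
        min 1 (bundleValue m (removeGoods {a, b} v) p' j) = min 1 (bundleValue m v p j) := by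
      intro j hj
      simp only [mem_erase] at hj
      rw [bundleValue_removeGoods_of_forall_ne (by
        simp [hp', Ne.symm hj.1]), bundleValue, bundleValue]
      congr 2
      refine filter_congr fun g _ => ?_
      by_cases hg : p g = p a
      · simp [hp', hg, Ne.symm hj.1, Ne.symm hj.2.1]
      · simp [hp', hg]
    have hmerge : bundleValue m v p' (p b) = bundleValue m v p (p a) + bundleValue m v p (p b) := by
      rw [bundleValue, bundleValue, bundleValue, sum_filter, sum_filter, sum_filter,
        ← sum_add_distrib]
      refine sum_congr rfl fun g _ => ?_
      by_cases hg : p g = p a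
      · simp [hp', hg, Ne.symm hpab]
      · simp [hp', hg]
    have hrest := bundleValue_le_bundleValue_removeGoods (m := m) hv p' (p b) {a, b}
    rw [sum_pair hab, hmerge] at hrest
    have hmin : bundleValue m v p (p a) + bundleValue m v p (p b) - 1 - η ≤
        min 1 (bundleValue m (removeGoods {a, b} v) p' (p b)) :=
      le_min (by linarith [hp _ (hpJ a), hp _ (hpJ b)]) (by linarith)
    rw [← sum_min_bundleValue hpJ hp, ← add_sum_erase J _ (hpJ a), ← add_sum_erase _ _ hb] at hc
    rw [← add_sum_erase _ _ hb, sum_congr rfl hother]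
    linarith [min_le_right 1 (bundleValue m v p (p a)), min_le_right 1 (bundleValue m v p (p b))]

/-- Moving a less valuable good into the bundle `j₀` in exchange for a more valuable one does not
decrease the value of the other bundles. -/
lemma exists_exchange {m : ℕ} {v : ℕ → ℝ} {p : ℕ → ℕ} {J : Finset ℕ} {j₀ : ℕ} {c : ℝ}
    (hc : c ≤ ∑ j ∈ J.erase j₀, min 1 (bundleValue m v p j)) {a b : ℕ} (ha : a < m) (hb : b < m)
    (hab : v b ≤ v a) (hpa : p a = j₀) :
    ∃ p' : ℕ → ℕ, c ≤ ∑ j ∈ J.erase j₀, min 1 (bundleValue m v p' j) ∧ p' b = j₀ ∧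
      ∀ g, g ≠ a → g ≠ b → p' g = p g := by
  have hlt : ∀ g, Equiv.swap a b g < m ↔ g < m := fun g => by
    rw [Equiv.swap_apply_def]
    split_ifs with h1 h2
    · simp [h1, ha, hb]
    · simp [h2, ha, hb]
    · rfl
  refine ⟨p ∘ Equiv.swap a b, hc.trans (sum_le_sum fun j hj => min_le_min_left _ ?_), by simp [hpa],
    fun g h1 h2 => by simp [Equiv.swap_apply_of_ne_of_ne h1 h2]⟩
  have hswap : bundleValue m v (p ∘ Equiv.swap a b) j =
      ∑ g ∈ range m with p g = j, v (Equiv.swap a b g) :=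
    sum_equiv (Equiv.swap a b) (by simp [hlt]) (by simp)
  rw [hswap]
  refine sum_le_sum fun g hg => ?_
  rw [Equiv.swap_apply_def]
  split_ifs with h1 h2
  · rw [h1] at hg
    exact absurd ((mem_filter.1 hg).2.symm.trans hpa) (ne_of_mem_erase hj)
  · rwa [h2]
  · rfl

lemma HasNormalizedPartition.remove_three {m n : ℕ} {v : ℕ → ℝ} {c : ℝ}
    (h : HasNormalizedPartition m v n c) (hanti : Antitone v) (hn : 1 ≤ n) (hm : 2 * n < m) :
    HasCappedPartition m (removeGoods {2 * n - 2, 2 * n - 1, 2 * n} v) (n - 1) (c - 1) := by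
  obtain ⟨p, J, hJ, hpJ, hp, hc⟩ := h
  obtain ⟨j₀, hj₀, hcard⟩ := exists_lt_card_fiber_of_mul_lt_card_of_maps_to
    (s := range (2 * n + 1)) (t := J) (f := p) (n := 2) (fun g _ => hpJ g)
    (by rw [hJ, card_range]; omega)
  set e := orderEmbOfCardLe {g ∈ range (2 * n + 1) | p g = j₀} (k := 3) hcard with he
  have hmem : ∀ k, e k < 2 * n + 1 ∧ p (e k) = j₀ := fun k => by
    simpa using orderEmbOfCardLe_mem _ hcard k
  have h01 : e 0 < e 1 := e.strictMono (by decide)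
  have h12 : e 1 < e 2 := e.strictMono (by decide)
  obtain ⟨h0, hp0⟩ := hmem 0
  obtain ⟨h1, hp1⟩ := hmem 1
  obtain ⟨h2, hp2⟩ := hmem 2
  rw [show n - 1 = (J.erase j₀).card by rw [card_erase_of_mem hj₀, hJ]]
  obtain ⟨p₁, hc₁, hpc, hp₁⟩ := exists_exchange (le_sum_erase_min_bundleValue hpJ hp hc hj₀)
    (by omega) hm (hanti (by omega)) hp2
  obtain ⟨p₂, hc₂, hpb, hp₂⟩ := exists_exchange hc₁ (b := 2 * n - 1) (by omega) (by omega)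
    (hanti (by omega)) ((hp₁ (e 1) (by omega) (by omega)).trans hp1)
  obtain ⟨p₃, hc₃, hpa, hp₃⟩ := exists_exchange hc₂ (b := 2 * n - 2) (by omega) (by omega)
    (hanti (by omega)) ((hp₂ (e 0) (by omega) (by omega)).trans
      ((hp₁ (e 0) (by omega) (by omega)).trans hp0))
  refine .of_labels hc₃ ?_
  have hb' := (hp₃ (2 * n - 1) (by omega) (by omega)).trans hpb
  have hc' := (hp₃ (2 * n) (by omega) (by omega)).trans
    ((hp₂ (2 * n) (by omega) (by omega)).trans hpc)
  simp [hpa, hb', hc']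

lemma exists_sorted {ι : Type*} [DecidableEq ι] [Nonempty ι] {m n : ℕ} {c : ℝ} {v : ι → ℕ → ℝ}
    (hv : ∀ i g, 0 ≤ v i g) (hn : 1 ≤ n) {S : Finset ι}
    (hS : ∀ i ∈ S, HasCappedPartition m (v i) n c) :
    ∃ u : ι → ℕ → ℝ, (∀ i g, 0 ≤ u i g) ∧ (∀ i, Antitone (u i)) ∧
      (∀ i ∈ S, HasNormalizedPartition m (u i) n c) ∧
      ∀ a : ℕ → ι, ∃ b : ℕ → ι, ∀ i, ∑ g ∈ range m with a g = i, u i g ≤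
        ∑ g ∈ range m with b g = i, v i g := by
  have hw : ∀ i, ∃ w : ℕ → ℝ, (∀ g, 0 ≤ w g) ∧ (∀ g, w g ≤ v i g) ∧ (∀ g, m ≤ g → w g = 0) ∧
      (i ∈ S → HasNormalizedPartition m w n c) := by
    intro i
    by_cases hi : i ∈ S
    · obtain ⟨w, h0, h1, h2, h3⟩ := (hS i hi).exists_normalized hn (hv i)
      exact ⟨w, h0, h1, h2, fun _ => h3⟩
    · exact ⟨fun _ => 0, fun _ => le_rfl, hv i, fun _ _ => rfl, fun h => absurd h hi⟩
  choose w hw0 hwv hwm hwS using hw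
  choose σ hσ hanti using fun i => exists_perm_antitone (hw0 i) (hwm i)
  refine ⟨fun i => w i ∘ σ i, fun i g => hw0 i _, hanti, fun i hi => (hwS i hi).comp_perm _ (hσ i),
    fun a => ?_⟩
  obtain ⟨b, hb⟩ := exists_picking hw0 σ hσ hanti a
  exact ⟨b, fun i => (hb i).trans (sum_le_sum fun g _ => hwv i g)⟩

/-- When none of the reductions applies, bag filling succeeds. -/
lemma exists_allocation_of_irreducible {ι : Type*} [DecidableEq ι] [Nonempty ι] {m N : ℕ}
    {S : Finset ι} (hSN : S.card ≤ N) (hm : 2 * S.card ≤ m) {u : ι → ℕ → ℝ}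
    (hu : ∀ i g, 0 ≤ u i g) (hanti : ∀ i, Antitone (u i))
    (hpart : ∀ i ∈ S, HasNormalizedPartition m (u i) S.card (S.card - (N - S.card) / (9 * N)))
    (h0 : ∀ i ∈ S, u i 0 < 3 / 4 + 1 / (12 * N))
    (hsmall : ∀ i ∈ S, 3 * u i (2 * S.card) ≤ 3 / 4 + 1 / (12 * N))
    (h02 : ∀ i ∈ S, u i 0 + u i (2 * S.card) ≤ 3 / 4 + 1 / (12 * N)) :
    ∃ a : ℕ → ι, ∀ i ∈ S, 3 / 4 + 1 / (12 * N) ≤ ∑ g ∈ range m with a g = i, u i g := by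
  set n := S.card with hn
  rcases exists_bag_filling (α := 3 / 4 + 1 / (12 * N)) hu
    (fun i k => u i k + u i (2 * n - 1 - k)) (fun i => u i (2 * n)) S (range n) (Ico (2 * n) m)
    (by rw [card_range]) (fun i _ g hg => hanti i (mem_Ico.1 hg).1) with
    ⟨c, f, h⟩ | ⟨i, hi, c, hc, ⟨k₀, hk₀, hlt⟩, hfill⟩
  · refine ⟨fun g => f (if g < n then g else if g < 2 * n then 2 * n - 1 - g else c g),
      fun i hi => ?_⟩
    obtain ⟨k, hk, hfk, hle⟩ := h i hi
    rw [mem_range] at hk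
    refine hle.trans ?_
    have hdisj : Disjoint ({k, 2 * n - 1 - k} : Finset ℕ)
        ({g ∈ Ico (2 * n) m | c g = k} : Finset ℕ) := by
      rw [disjoint_left]
      intro g hg hg'
      simp only [mem_insert, mem_singleton, mem_filter, mem_Ico] at hg hg'
      omega
    rw [← sum_pair (show k ≠ 2 * n - 1 - k by omega), ← sum_union hdisj]
    refine sum_le_sum_of_subset_of_nonneg (fun g hg => ?_) fun g _ _ => hu i g
    simp only [mem_union, mem_insert, mem_singleton, mem_filter, mem_Ico] at hg
    simp only [mem_filter, mem_range]
    rcases hg with (rfl | rfl) | ⟨⟨h1, h2⟩, h3⟩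
    · exact ⟨by omega, by rw [if_pos hk, hfk]⟩
    · refine ⟨by omega, ?_⟩
      rw [if_neg (by omega), if_pos (by omega), show 2 * n - 1 - (2 * n - 1 - k) = k by omega, hfk]
    · exact ⟨h2, by rw [if_neg (by omega), if_neg (by omega), h3, hfk]⟩
  · refine absurd ?_ (not_isStuck (c := c) (k₀ := k₀) (hu i) (hanti i) hm hSN (hpart i hi)
      (h0 i hi) (hsmall i hi) (h02 i hi))
    exact ⟨fun g hg => hc g hg, mem_range.1 hk₀, hlt,
      fun k hk => hfill k (mem_range.2 hk)⟩

/-- When some agent is satisfied with the goods of `R`, it leaves with them. -/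
lemma exists_allocation_of_remove {ι : Type*} [DecidableEq ι] {m : ℕ} {S : Finset ι} {α : ℝ}
    {u : ι → ℕ → ℝ} (hu : ∀ i g, 0 ≤ u i g) {R : Finset ℕ} (hR : ∀ g ∈ R, g < m) {i₀ : ι}
    (hi₀ : α ≤ ∑ g ∈ R, u i₀ g) {a : ℕ → ι}
    (ha : ∀ i ∈ S.erase i₀, α ≤ ∑ g ∈ range m with a g = i, removeGoods R (u i) g) :
    ∃ a : ℕ → ι, ∀ i ∈ S, α ≤ ∑ g ∈ range m with a g = i, u i g := by
  refine ⟨fun g => if g ∈ R then i₀ else a g, fun i hi => ?_⟩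
  by_cases hii : i = i₀
  · subst hii
    refine hi₀.trans (sum_le_sum_of_subset_of_nonneg (fun g hg => ?_) fun g _ _ => hu i g)
    simp [hg, hR g hg]
  · refine (ha i (mem_erase.2 ⟨hii, hi⟩)).trans ?_
    rw [sum_filter, sum_filter]
    refine sum_le_sum fun g _ => ?_
    by_cases hg : g ∈ R
    · simp [removeGoods, hg, Ne.symm hii]
    · simp [removeGoods, hg]

lemma HasCappedPartition.mono {m n : ℕ} {v : ℕ → ℝ} {c d : ℝ} (h : HasCappedPartition m v n c)
    (hd : d ≤ c) : HasCappedPartition m v n d := by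
  obtain ⟨p, J, hJ, hc⟩ := h
  exact ⟨p, J, hJ, hd.trans hc⟩

theorem exists_allocation_of_hasCappedPartition {ι : Type*} [DecidableEq ι] [Nonempty ι]
    {m N : ℕ} (hN : 1 ≤ N) (hm : 2 * N < m) (S : Finset ι) :
    S.card ≤ N → ∀ v : ι → ℕ → ℝ, (∀ i g, 0 ≤ v i g) →
    (∀ i ∈ S, HasCappedPartition m (v i) S.card (S.card - (N - S.card) / (9 * N))) →
    ∃ a : ℕ → ι, ∀ i ∈ S, 3 / 4 + 1 / (12 * N) ≤ ∑ g ∈ range m with a g = i, v i g := by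
  induction S using Finset.strongInduction with
  | H S ih =>
    intro hSN v hv hS
    rcases S.eq_empty_or_nonempty with rfl | hne
    · exact ⟨fun _ => Classical.arbitrary ι, by simp⟩
    have hn : 1 ≤ S.card := card_pos.2 hne
    obtain ⟨u, hu, hanti, hpart, hpick⟩ := exists_sorted hv hn hS
    suffices h : ∃ a : ℕ → ι, ∀ i ∈ S, 3 / 4 + 1 / (12 * (N : ℝ)) ≤
        ∑ g ∈ range m with a g = i, u i g by
      obtain ⟨a, ha⟩ := h
      obtain ⟨b, hb⟩ := hpick a
      exact ⟨b, fun i hi => (ha i hi).trans (hb i)⟩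
    have hN' : (0 : ℝ) < N := by exact_mod_cast hN
    have hη : (0 : ℝ) ≤ 1 / (9 * N) := by positivity
    have hremove : ∀ R : Finset ℕ, (∀ g ∈ R, g < m) → (∀ i ∈ S, HasCappedPartition m
        (removeGoods R (u i)) (S.card - 1)
        (S.card - (N - S.card) / (9 * N) - 1 - 1 / (9 * N))) →
        (∃ i ∈ S, 3 / 4 + 1 / (12 * (N : ℝ)) ≤ ∑ g ∈ R, u i g) →
        ∃ a : ℕ → ι, ∀ i ∈ S, 3 / 4 + 1 / (12 * (N : ℝ)) ≤
          ∑ g ∈ range m with a g = i, u i g := by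
      rintro R hRm hR ⟨i₀, hi₀, hle⟩
      have hcard : (S.erase i₀).card = S.card - 1 := card_erase_of_mem hi₀
      obtain ⟨a, ha⟩ := ih (S.erase i₀) (erase_ssubset hi₀) (by omega)
        (fun i => removeGoods R (u i)) (fun i => removeGoods_nonneg R (hu i)) fun i hi => by
          rw [hcard]
          convert hR i (mem_of_mem_erase hi) using 1
          push_cast [hn]
          field_simp
          ring
      exact exists_allocation_of_remove hu hRm hle ha
    by_cases h1 : ∃ i ∈ S, 3 / 4 + 1 / (12 * (N : ℝ)) ≤ ∑ g ∈ {0}, u i g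
    · exact hremove {0} (by simp; omega)
        (fun i hi => ((hpart i hi).remove_one 0).mono (by linarith)) h1
    by_cases h3 : ∃ i ∈ S, 3 / 4 + 1 / (12 * (N : ℝ)) ≤
        ∑ g ∈ {2 * S.card - 2, 2 * S.card - 1, 2 * S.card}, u i g
    · exact hremove _ (by simp; omega)
        (fun i hi => ((hpart i hi).remove_three (hanti i) hn (by omega)).mono (by linarith)) h3
    push Not at h1 h3
    have hsmall : ∀ i ∈ S, 3 * u i (2 * S.card) < 3 / 4 + 1 / (12 * N) := fun i hi => by
      have h := h3 i hi
      rw [sum_insert (by simp; omega), sum_pair (by omega)] at h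
      have h' := hanti i (show 2 * S.card - 2 ≤ 2 * S.card by omega)
      have h'' := hanti i (show 2 * S.card - 1 ≤ 2 * S.card by omega)
      linarith
    simp only [sum_singleton] at h1
    by_cases h4 : ∃ i ∈ S, 3 / 4 + 1 / (12 * (N : ℝ)) ≤ ∑ g ∈ {0, 2 * S.card}, u i g
    · refine hremove _ (by simp; omega) (fun i hi => ?_) h4
      refine (hpart i hi).remove_two (hu i) (by omega) hη ?_
      have h := h1 i hi
      have h' := hsmall i hi
      have hη' : 1 / (9 * (N : ℝ)) = 4 / 3 * (1 / (12 * N)) := by field_simp; norm_num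
      linarith
    push Not at h4
    refine exists_allocation_of_irreducible hSN (by omega) hu hanti hpart h1
      (fun i hi => (hsmall i hi).le) fun i hi => ?_
    have h := h4 i hi
    rw [sum_pair (by omega)] at h
    exact h.le

/-- The valuation of the goods `0, …, m - 1` extended by worthless goods. -/
noncomputable def extendByZero {m : ℕ} (v : Fin m → ℝ) (g : ℕ) : ℝ :=
  if h : g < m then v ⟨g, h⟩ else 0

lemma extendByZero_val {m : ℕ} (v : Fin m → ℝ) (k : Fin m) : extendByZero v k = v k := by
  simp [extendByZero]

lemma extendByZero_nonneg {m : ℕ} {v : Fin m → ℝ} (hv : ∀ k, 0 ≤ v k) (g : ℕ) :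
    0 ≤ extendByZero v g := by
  unfold extendByZero
  split_ifs
  exacts [hv _, le_rfl]

lemma sum_extendByZero {m : ℕ} (v : Fin m → ℝ) {ι : Type*} [DecidableEq ι] (a : ℕ → ι) (i : ι)
    (l : ℕ) : ∑ g ∈ range (m + l) with a g = i, extendByZero v g =
      ∑ k ∈ {k : Fin m | a k = i}, v k := by
  rw [sum_filter, sum_range_add, sum_range, sum_filter, sum_eq_zero (s := range l), add_zero]
  · simp only [extendByZero_val]
  · intro g _
    simp [extendByZero]

/-- A partition into `n` bundles of value at least `μ` gives, after rescaling by `μ`, a capped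
partition into any smaller number of bundles. -/
lemma hasCappedPartition_of_partition {n m l s : ℕ} {v : Fin m → ℝ} (hv : ∀ k, 0 ≤ v k)
    {P : Fin n → Finset (Fin m)} (hdisj : ∀ j j', j ≠ j' → Disjoint (P j) (P j'))
    (hunion : univ.biUnion P = univ) {μ : ℝ} (hμ : 0 < μ) (hP : ∀ j, μ ≤ ∑ k ∈ P j, v k)
    (hs : s ≤ n) : HasCappedPartition (m + l) (fun g => extendByZero v g / μ) s s := by
  have hex : ∀ k, ∃ j, k ∈ P j := fun k => by
    have := mem_univ k
    rw [← hunion] at this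
    simpa using this
  choose label hlabel using hex
  have hlabel_eq : ∀ j, ∀ k ∈ P j, label k = j := fun j k hk => by
    by_contra hne
    exact disjoint_left.1 (hdisj _ _ hne) (hlabel k) hk
  refine ⟨fun g => if h : g < m then label ⟨g, h⟩ else 0, range s, card_range s, ?_⟩
  have hone : ∀ j ∈ range s, 1 ≤ bundleValue (m + l) (fun g => extendByZero v g / μ)
      (fun g => if h : g < m then (label ⟨g, h⟩ : ℕ) else 0) j := by
    intro j hj
    rw [mem_range] at hj
    have hle := sum_le_bundleValue (m := m + l) (v := fun g => extendByZero v g / μ)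
      (fun g => div_nonneg (extendByZero_nonneg hv g) hμ.le)
      (p := fun g => if h : g < m then (label ⟨g, h⟩ : ℕ) else 0) (j := j)
      (s := (P ⟨j, by omega⟩).map Fin.valEmbedding) (by
        intro g hg
        obtain ⟨k, hk, rfl⟩ := mem_map.1 hg
        refine ⟨?_, by simp [hlabel_eq _ k hk]⟩
        simp only [Fin.valEmbedding_apply]
        omega)
    refine le_trans ?_ hle
    rw [sum_map]
    simp only [Fin.valEmbedding_apply, extendByZero_val]
    rw [← sum_div, one_le_div hμ]
    exact hP _
  rw [sum_congr rfl fun j hj => min_eq_left (hone j hj)]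
  simp

end MaximinShare

/-- For every number of agents `n ≥ 1` and every finite set of `m` indivisible
goods with additive valuations (nonnegative item values), there exists a complete allocation
that is `(3/4 + 1/(12n))`-MMS: every agent `i` receives at least `(3/4 + 1/(12n))·μ_i`,
where `μ_i` is the maximin share (so the bound holds against the minimum bundle of every
partition). -/
theorem approx_mms_exists_goods (n m : ℕ) (hn : 1 ≤ n)
    (v : Fin n → Fin m → ℝ)
    (hv : ∀ i k, 0 ≤ v i k) :
    ∃ A : Fin n → Finset (Fin m),
      (∀ i j, i ≠ j → Disjoint (A i) (A j)) ∧
      Finset.univ.biUnion A = Finset.univ ∧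
      ∀ i : Fin n, ∀ P : Fin n → Finset (Fin m),
        (∀ j l, j ≠ l → Disjoint (P j) (P l)) →
        Finset.univ.biUnion P = Finset.univ →
        (3 / 4 + 1 / (12 * (n : ℝ))) *
            Finset.univ.inf' (Finset.univ_nonempty_iff.mpr ⟨⟨0, hn⟩⟩)
              (fun j => ∑ k ∈ P j, v i k) ≤
          ∑ k ∈ A i, v i k := by
  classical
  have hbest : ∀ i, ∃ P : Fin n → Finset (Fin m), ∃ μ : ℝ,
      (∀ j l, j ≠ l → Disjoint (P j) (P l)) ∧ Finset.univ.biUnion P = Finset.univ ∧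
      (∀ j, μ ≤ ∑ k ∈ P j, v i k) ∧ 0 ≤ μ ∧ ∀ Q : Fin n → Finset (Fin m),
        (∀ j l, j ≠ l → Disjoint (Q j) (Q l)) → Finset.univ.biUnion Q = Finset.univ →
        Finset.univ.inf' (Finset.univ_nonempty_iff.mpr ⟨⟨0, hn⟩⟩)
          (fun j => ∑ k ∈ Q j, v i k) ≤ μ := by
    intro i
    obtain ⟨P, hP, hmax⟩ := Finset.exists_max_image
      {P : Fin n → Finset (Fin m) | (∀ j l, j ≠ l → Disjoint (P j) (P l)) ∧
        Finset.univ.biUnion P = Finset.univ}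
      (fun P => Finset.univ.inf' (Finset.univ_nonempty_iff.mpr ⟨⟨0, hn⟩⟩)
        fun j => ∑ k ∈ P j, v i k)
      ⟨fun j => if j = ⟨0, hn⟩ then Finset.univ else ∅, by
        rw [Finset.mem_filter]
        refine ⟨Finset.mem_univ _, fun j l hjl => ?_, ?_⟩
        · by_cases hj : j = ⟨0, hn⟩
          · simp [← hj, Ne.symm hjl]
          · simp [hj]
        · ext k
          simp only [Finset.mem_biUnion, Finset.mem_univ, true_and, iff_true]
          exact ⟨⟨0, hn⟩, by simp⟩⟩
    simp only [Finset.mem_filter, Finset.mem_univ, true_and] at hP hmax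
    exact ⟨P, _, hP.1, hP.2, fun j => Finset.inf'_le _ (Finset.mem_univ j),
      Finset.le_inf' _ _ fun j _ => Finset.sum_nonneg fun k _ => hv i k,
      fun Q h1 h2 => hmax Q ⟨h1, h2⟩⟩
  choose P μ hdisj hunion hμP hμ0 hmax using hbest
  have : Nonempty (Fin n) := ⟨⟨0, hn⟩⟩
  have hcard : Finset.card {i | 0 < μ i} ≤ n :=
    (Finset.card_le_univ _).trans_eq (Fintype.card_fin n)
  obtain ⟨a, ha⟩ := MaximinShare.exists_allocation_of_hasCappedPartition hn
    (m := m + (2 * n + 1)) (by omega) {i | 0 < μ i} hcard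
    (fun i g => MaximinShare.extendByZero (v i) g / μ i)
    (fun i g => div_nonneg (MaximinShare.extendByZero_nonneg (hv i) g) (hμ0 i)) fun i hi => by
      refine (MaximinShare.hasCappedPartition_of_partition (hv i) (hdisj i) (hunion i)
        (Finset.mem_filter.1 hi).2 (hμP i) hcard).mono (sub_le_self _ ?_)
      exact div_nonneg (sub_nonneg.2 (by exact_mod_cast hcard)) (by positivity)
  refine ⟨fun i => {k | a k = i}, fun i j hij => ?_, ?_, fun i Q hQ hQ' => ?_⟩
  · rw [Finset.disjoint_filter]
    rintro k - rfl
    exact hij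
  · ext k
    simp
  · refine (mul_le_mul_of_nonneg_left (hmax i Q hQ hQ') (by positivity)).trans ?_
    rcases (hμ0 i).eq_or_lt with h | h
    · rw [← h, mul_zero]
      exact Finset.sum_nonneg fun k _ => hv i k
    · have hi := ha i (Finset.mem_filter.2 ⟨Finset.mem_univ i, h⟩)
      rwa [← Finset.sum_div, MaximinShare.sum_extendByZero, le_div_iff₀ h] at hi
end

section
/- For every number of agents n ≥ 1 and every finite set M of m indivisible chores, if each agent i has an additive cost function with nonnegative item costs c_i(k) ≥ 0, then there exists a complete allocation A = (A_1,…,A_n) that is 11/9-MMS for chores: for every agent i, c_i(A_i) ≤ (11/9)·MMS_i, where MMS_i = min over all partitions (P_1,…,P_n) of M into n bundles of max_j c_i(P_j). -/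
/-- The items of `M` are ordered by decreasing cost `v`, and `z` is the last of them. The bundle
`k ∈ K` consists of the items labelled `k` by `a`; every item other than `z` lies in a bundle, and
no item left over after bundle `k` could have been added to `k` at its turn without exceeding
`11 * b`. The labelling `g` splits `M` into as many parts, each of cost at most `9 * b`. -/
structure GreedyConfig {ι : Type*} [LinearOrder ι] (v : ι → ℝ) (b : ℝ) (z : ι) (a : ι → ℕ)
    (M : Finset ι) (K J : Finset ℕ) (g : ι → ℕ) : Prop where
  card_eq : J.card = K.card
  mem : z ∈ M
  le_last : ∀ x ∈ M, x ≤ z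
  label_mem : ∀ x ∈ M, x ≠ z → a x ∈ K
  lt_label_last : ∀ k ∈ K, k < a z
  greedy : ∀ k ∈ K, ∀ y ∈ M, k < a y →
    11 * b < ∑ x ∈ M with (a x = k ∧ x < y), v x + v y
  part_mem : ∀ x ∈ M, g x ∈ J
  part_le : ∀ j ∈ J, ∑ x ∈ M with g x = j, v x ≤ 9 * b

namespace GreedyConfig

variable {ι : Type*} [LinearOrder ι] {v : ι → ℝ} {b : ℝ} {z : ι} {a : ι → ℕ}
  {M : Finset ι} {K J : Finset ℕ} {g : ι → ℕ}

lemma remove (h : GreedyConfig v b z a M K J g) {k j : ℕ} (hk : k ∈ K) (hj : j ∈ J) {g' : ι → ℕ}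
    (hg : ∀ x ∈ M, a x ≠ k → g' x ∈ J.erase j)
    (hs : ∀ i ∈ J.erase j, ∑ x ∈ M with (a x ≠ k ∧ g' x = i), v x ≤ 9 * b) :
    GreedyConfig v b z a {x ∈ M | a x ≠ k} (K.erase k) (J.erase j) g' where
  card_eq := by rw [Finset.card_erase_of_mem hk, Finset.card_erase_of_mem hj, h.card_eq]
  mem := by simpa [h.mem] using (h.lt_label_last k hk).ne'
  le_last x hx := h.le_last x (Finset.mem_filter.1 hx).1
  label_mem x hx hxz := by
    rw [Finset.mem_filter] at hx
    exact Finset.mem_erase.2 ⟨hx.2, h.label_mem x hx.1 hxz⟩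
  lt_label_last i hi := h.lt_label_last i (Finset.mem_of_mem_erase hi)
  greedy i hi y hy hiy := by
    rw [Finset.mem_erase] at hi
    have := h.greedy i hi.2 y (Finset.mem_filter.1 hy).1 hiy
    rw [Finset.filter_filter]
    convert this using 4
    constructor
    · exact fun hx => hx.2
    · exact fun hx => ⟨hx.1 ▸ hi.1, hx⟩
  part_mem x hx := by
    rw [Finset.mem_filter] at hx
    exact hg x hx.1 hx.2
  part_le i hi := by
    rw [Finset.filter_filter]
    exact hs i hi

lemma remove_of_subset (h : GreedyConfig v b z a M K J g) (hv : ∀ x, 0 ≤ v x) {k j : ℕ}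
    (hk : k ∈ K) (hj : j ∈ J) (hs : ∀ x ∈ M, g x = j → a x = k) :
    GreedyConfig v b z a {x ∈ M | a x ≠ k} (K.erase k) (J.erase j) g := by
  refine h.remove hk hj (fun x hx hxk => Finset.mem_erase.2 ⟨fun e => hxk (hs x hx e),
    h.part_mem x hx⟩) fun i hi => ?_
  refine le_trans (Finset.sum_le_sum_of_subset_of_nonneg ?_ fun x _ _ => hv x)
    (h.part_le i (Finset.mem_of_mem_erase hi))
  intro x hx
  simp only [Finset.mem_filter] at hx ⊢
  exact ⟨hx.1, hx.2.2⟩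

lemma remove_of_exchange (h : GreedyConfig v b z a M K J g) (hv : ∀ x, 0 ≤ v x) {k j : ℕ}
    (hk : k ∈ K) (hj : j ∈ J) {u w : ι} (hw : w ∈ M) (haw : a w = k) (hgw : g w ≠ j)
    (hau : a u ≠ k) (hvuw : v u ≤ v w) (hs : ∀ x ∈ M, g x = j → a x = k ∨ x = u) :
    GreedyConfig v b z a {x ∈ M | a x ≠ k} (K.erase k) (J.erase j)
      (Function.update g u (g w)) := by
  refine h.remove hk hj (fun x hx hxk => ?_) fun i hi => ?_
  · rw [Finset.mem_erase]
    by_cases hxu : x = u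
    · subst hxu
      simpa using ⟨hgw, h.part_mem w hw⟩
    · rw [Function.update_of_ne hxu]
      exact ⟨fun e => (hs x hx e).elim hxk hxu, h.part_mem x hx⟩
  · have hi' := h.part_le i (Finset.mem_of_mem_erase hi)
    by_cases hiw : i = g w
    · have hwi : w ∈ ({x ∈ M | g x = i} : Finset ι) := by simp [hw, hiw]
      have hsub : ({x ∈ M | a x ≠ k ∧ Function.update g u (g w) x = i} : Finset ι) ⊆
          insert u (({x ∈ M | g x = i} : Finset ι).erase w) := by
        intro x hx
        simp only [Finset.mem_filter, Finset.mem_insert, Finset.mem_erase] at hx ⊢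
        by_cases hxu : x = u
        · exact Or.inl hxu
        · rw [Function.update_of_ne hxu] at hx
          exact Or.inr ⟨fun e => hx.2.1 (e ▸ haw), hx.1, hx.2.2⟩
      have h1 := Finset.sum_le_sum_of_subset_of_nonneg hsub fun x _ _ => hv x
      have h2 := Finset.add_sum_erase _ v hwi
      have h3 : ∑ x ∈ insert u (({x ∈ M | g x = i} : Finset ι).erase w), v x ≤
          v u + ∑ x ∈ ({x ∈ M | g x = i} : Finset ι).erase w, v x := by
        by_cases hu : u ∈ (({x ∈ M | g x = i} : Finset ι).erase w)
        · rw [Finset.insert_eq_of_mem hu]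
          linarith [hv u]
        · rw [Finset.sum_insert hu]
      linarith
    · refine le_trans (Finset.sum_le_sum_of_subset_of_nonneg ?_ fun x _ _ => hv x) hi'
      intro x hx
      simp only [Finset.mem_filter] at hx ⊢
      by_cases hxu : x = u
      · subst hxu
        exact absurd (by simpa using hx.2.2.symm) hiw
      · rw [Function.update_of_ne hxu] at hx
        exact ⟨hx.1, hx.2.2⟩

lemma le_bound (h : GreedyConfig v b z a M K J g) (hv : ∀ x, 0 ≤ v x) {x : ι} (hx : x ∈ M) :
    v x ≤ 9 * b :=
  le_trans (Finset.single_le_sum (f := v) (fun y _ => hv y) (by simpa using hx))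
    (h.part_le (g x) (h.part_mem x hx))

lemma exists_lt (h : GreedyConfig v b z a M K J g) (hv : ∀ x, 0 ≤ v x) {k : ℕ} (hk : k ∈ K)
    {y : ι} (hy : y ∈ M) (hky : k < a y) : ∃ x ∈ M, a x = k ∧ x < y := by
  by_contra! hne
  have h1 := h.greedy k hk y hy hky
  rw [Finset.filter_false_of_mem fun x hx hc => (hne x hx hc.1).not_gt hc.2,
    Finset.sum_empty] at h1
  linarith [h.le_bound hv hy, hv y]

/-- A part with at most two items is dominated by a bundle, so both can be dropped. -/
lemma exists_smaller (h : GreedyConfig v b z a M K J g) (hv : ∀ x, 0 ≤ v x) (hanti : Antitone v)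
    {j : ℕ} (hj : j ∈ J) (hcard : ({x ∈ M | g x = j} : Finset ι).card ≤ 2) :
    ∃ k ∈ K, ∃ g', GreedyConfig v b z a {x ∈ M | a x ≠ k} (K.erase k) (J.erase j) g' := by
  have hK : K.Nonempty := by
    rw [← Finset.card_pos, ← h.card_eq]
    exact Finset.card_pos.2 ⟨j, hj⟩
  have hmem : ∀ x, x ∈ ({x ∈ M | g x = j} : Finset ι) ↔ x ∈ M ∧ g x = j := by simp
  have hsum := h.part_le j hj
  generalize ({x ∈ M | g x = j} : Finset ι) = S at hcard hmem hsum
  have hcases : S.card = 0 ∨ S.card = 1 ∨ S.card = 2 := by omega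
  rcases hcases with h0 | h1 | h2
  · rw [Finset.card_eq_zero] at h0
    subst h0
    obtain ⟨k, hk⟩ := hK
    exact ⟨k, hk, g, h.remove_of_subset hv hk hj fun x hx e => by simpa using (hmem x).2 ⟨hx, e⟩⟩
  · obtain ⟨p, rfl⟩ := Finset.card_eq_one.1 h1
    have hp := (hmem p).1 (by simp)
    have hS : ∀ x ∈ M, g x = j → x = p := fun x hx e => by simpa using (hmem x).2 ⟨hx, e⟩
    have hk := K.min'_mem hK
    refine ⟨_, hk, ?_⟩
    have hle : K.min' hK ≤ a p := by
      by_cases hpz : p = z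
      · rw [hpz]
        exact (h.lt_label_last _ hk).le
      · exact K.min'_le _ (h.label_mem p hp.1 hpz)
    rcases hle.eq_or_lt with heq | hlt
    · exact ⟨g, h.remove_of_subset hv hk hj fun x hx e => by rw [hS x hx e, heq]⟩
    · obtain ⟨w, hw, haw, hwp⟩ := h.exists_lt hv hk hp.1 hlt
      exact ⟨_, h.remove_of_exchange hv hk hj hw haw (fun e => hwp.ne (hS w hw e)) hlt.ne'
        (hanti hwp.le) fun x hx e => Or.inr (hS x hx e)⟩
  · obtain ⟨p, q, hpq, rfl⟩ : ∃ p q, p < q ∧ S = {p, q} := by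
      obtain ⟨p, q, hne, rfl⟩ := Finset.card_eq_two.1 h2
      rcases hne.lt_or_gt with hlt | hlt
      · exact ⟨p, q, hlt, rfl⟩
      · exact ⟨q, p, hlt, Finset.pair_comm p q⟩
    have hp := (hmem p).1 (by simp)
    have hq := (hmem q).1 (by simp)
    have hS : ∀ x ∈ M, g x = j → x = p ∨ x = q := fun x hx e => by simpa using (hmem x).2 ⟨hx, e⟩
    rw [Finset.sum_pair hpq.ne] at hsum
    have hpK := h.label_mem p hp.1 (hpq.trans_le (h.le_last q hq.1)).ne
    rcases lt_trichotomy (a p) (a q) with hlt | heq | hgt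
    · obtain ⟨w, hw, haw, hwq, hwp⟩ : ∃ w ∈ M, a w = a p ∧ w < q ∧ w ≠ p := by
        by_contra! hne
        have h1 := h.greedy _ hpK q hq.1 hlt
        have h2 : ∑ x ∈ M with (a x = a p ∧ x < q), v x ≤ ∑ x ∈ {p}, v x := by
          refine Finset.sum_le_sum_of_subset_of_nonneg (fun x hx => ?_) fun x _ _ => hv x
          simp only [Finset.mem_filter] at hx
          simpa using hne x hx.1 hx.2.1 hx.2.2
        rw [Finset.sum_singleton] at h2
        linarith [hv p, hv q]
      refine ⟨_, hpK, _, h.remove_of_exchange hv hpK hj hw haw ?_ hlt.ne' (hanti hwq.le) ?_⟩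
      · exact fun e => (hS w hw e).elim hwp hwq.ne
      · exact fun x hx e => (hS x hx e).imp (fun e => by rw [e]) id
    · refine ⟨_, hpK, g, h.remove_of_subset hv hpK hj fun x hx e => ?_⟩
      rcases hS x hx e with rfl | rfl
      · rfl
      · exact heq.symm
    · have hqz : q ≠ z := by
        rintro rfl
        exact (h.lt_label_last _ hpK).not_gt hgt
      have hqK := h.label_mem q hq.1 hqz
      obtain ⟨w, hw, haw, hwp⟩ := h.exists_lt hv hqK hp.1 hgt
      refine ⟨_, hqK, _, h.remove_of_exchange hv hqK hj hw haw ?_ hgt.ne' (hanti hwp.le) ?_⟩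
      · exact fun e => (hS w hw e).elim hwp.ne (hwp.trans hpq).ne
      · exact fun x hx e => (hS x hx e).symm.imp (fun e => by rw [e]) id

lemma sum_eq_parts (h : GreedyConfig v b z a M K J g) (w : ι → ℝ) :
    ∑ x ∈ M, w x = ∑ j ∈ J, ∑ x ∈ M with g x = j, w x :=
  (Finset.sum_fiberwise_of_maps_to h.part_mem w).symm

lemma sum_eq_bundles (h : GreedyConfig v b z a M K J g) (w : ι → ℝ) :
    ∑ x ∈ M, w x = w z + ∑ k ∈ K, ∑ x ∈ M with a x = k, w x := by
  rw [← Finset.add_sum_erase M w h.mem, ← Finset.sum_fiberwise_of_maps_to (s := M.erase z)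
    (t := K) (g := a) fun x hx => h.label_mem x (Finset.mem_of_mem_erase hx)
      (Finset.ne_of_mem_erase hx)]
  congr 1
  refine Finset.sum_congr rfl fun k hk => Finset.sum_congr ?_ fun _ _ => rfl
  ext x
  simp only [Finset.mem_filter, Finset.mem_erase]
  constructor
  · exact fun hx => ⟨hx.1.2, hx.2⟩
  · rintro ⟨hx, hxk⟩
    refine ⟨⟨?_, hx⟩, hxk⟩
    rintro rfl
    exact (h.lt_label_last k hk).ne' hxk

lemma lt_bundle_add_last (h : GreedyConfig v b z a M K J g) (hv : ∀ x, 0 ≤ v x) {k : ℕ}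
    (hk : k ∈ K) : 11 * b < ∑ x ∈ M with a x = k, v x + v z := by
  refine (h.greedy k hk z h.mem (h.lt_label_last k hk)).trans_le ?_
  refine add_le_add_left
    (Finset.sum_le_sum_of_subset_of_nonneg (fun x hx => ?_) fun x _ _ => hv x) _
  simp only [Finset.mem_filter] at hx ⊢
  exact ⟨hx.1, hx.2.1⟩

lemma two_lt_last (h : GreedyConfig v b z a M K J g) (hv : ∀ x, 0 ≤ v x) : 2 * b < v z := by
  by_contra! hle
  have h1 := h.sum_eq_parts v
  rw [h.sum_eq_bundles v] at h1
  have h2 : ∑ j ∈ J, ∑ x ∈ M with g x = j, v x ≤ J.card * (9 * b) := by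
    rw [← nsmul_eq_mul]
    exact Finset.sum_le_card_nsmul _ _ _ h.part_le
  have hK : K.Nonempty := by
    rw [← Finset.card_pos, ← h.card_eq]
    exact Finset.card_pos.2 ⟨_, h.part_mem z h.mem⟩
  have h3 : ∑ k ∈ K, 9 * b < ∑ k ∈ K, ∑ x ∈ M with a x = k, v x :=
    Finset.sum_lt_sum_of_nonempty hK fun k hk => by linarith [h.lt_bundle_add_last hv hk]
  rw [Finset.sum_const, nsmul_eq_mul, ← h.card_eq] at h3
  linarith [hv z]

lemma last_le (h : GreedyConfig v b z a M K J g) (hanti : Antitone v) {x : ι} (hx : x ∈ M) :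
    v z ≤ v x := hanti (h.le_last x hx)

lemma add_card_mul_le (h : GreedyConfig v b z a M K J g) (hanti : Antitone v) {x : ι} (hx : x ∈ M) :
    v x + ((({y ∈ M | g y = g x} : Finset ι).card : ℝ) - 1) * v z ≤ 9 * b := by
  have hx' : x ∈ ({y ∈ M | g y = g x} : Finset ι) := by simp [hx]
  have h1 := h.part_le _ (h.part_mem x hx)
  rw [← Finset.add_sum_erase _ v hx'] at h1
  have h2 : (({y ∈ M | g y = g x} : Finset ι).erase x).card • v z ≤
      ∑ y ∈ ({y ∈ M | g y = g x} : Finset ι).erase x, v y :=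
    Finset.card_nsmul_le_sum _ _ _ fun y hy =>
      h.last_le hanti (Finset.mem_filter.1 (Finset.mem_of_mem_erase hy)).1
  rw [nsmul_eq_mul, Finset.cast_card_erase_of_mem hx'] at h2
  linarith

lemma le_of_three_le_card (h : GreedyConfig v b z a M K J g) (hv : ∀ x, 0 ≤ v x)
    (hanti : Antitone v) (hcard : ∀ j ∈ J, 3 ≤ ({x ∈ M | g x = j} : Finset ι).card) {x : ι}
    (hx : x ∈ M) : v x ≤ 9 * b - 2 * v z := by
  have h1 := h.add_card_mul_le hanti hx
  have h2 : (3 : ℝ) ≤ ({y ∈ M | g y = g x} : Finset ι).card := by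
    exact_mod_cast hcard _ (h.part_mem x hx)
  nlinarith [hv z]

/-- Item weights such that each part weighs at most `12`, while each bundle weighs at least `12`,
with at most one exception. -/
noncomputable def weight (b s c : ℝ) : ℝ :=
  if c ≤ (11 * b - s) / 3 then 3 else if c ≤ (9 * b - s) / 2 then 4
  else if c ≤ (16 * b - 2 * s) / 3 then 5 else 6

lemma three_le_weight (b s c : ℝ) : 3 ≤ weight b s c := by
  unfold weight
  split_ifs <;> norm_num

lemma exists_lt_lt_of_card_eq_three {S : Finset ι} (hS : S.card = 3) :
    ∃ x y t, x < y ∧ y < t ∧ S = {x, y, t} := by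
  obtain ⟨x, y, t, hxy, hxt, hyt, rfl⟩ := Finset.card_eq_three.1 hS
  rcases hxy.lt_or_gt with h1 | h1 <;> rcases hxt.lt_or_gt with h2 | h2 <;>
    rcases hyt.lt_or_gt with h3 | h3
  · exact ⟨x, y, t, h1, h3, rfl⟩
  · exact ⟨x, t, y, h2, h3, by grind⟩
  · exact absurd (h1.trans h3) h2.not_gt
  · exact ⟨t, x, y, h2, h1, by grind⟩
  · exact ⟨y, x, t, h1, h2, by grind⟩
  · exact absurd (h3.trans h1) h2.not_gt
  · exact ⟨y, t, x, h3, h2, by grind⟩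
  · exact ⟨t, y, x, h3, h1, by grind⟩

lemma sum_triple {x y t : ι} (hxy : x < y) (hyt : y < t) (f : ι → ℝ) :
    ∑ i ∈ {x, y, t}, f i = f x + f y + f t := by
  rw [Finset.sum_insert (by simp [hxy.ne, (hxy.trans hyt).ne]), Finset.sum_pair hyt.ne, add_assoc]

lemma weight_part_le (h : GreedyConfig v b z a M K J g) (hv : ∀ x, 0 ≤ v x)
    (hanti : Antitone v) (hcard : ∀ j ∈ J, 3 ≤ ({x ∈ M | g x = j} : Finset ι).card)
    (hz : 3 * v z < 7 * b) {j : ℕ} (hj : j ∈ J) :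
    ∑ x ∈ M with g x = j, weight b (v z) (v x) ≤ 12 := by
  have h2 := h.two_lt_last hv
  have h3 := hcard j hj
  have hpart := h.part_le j hj
  have hadd : ∀ x ∈ ({x ∈ M | g x = j} : Finset ι),
      v x + ((({x ∈ M | g x = j} : Finset ι).card : ℝ) - 1) * v z ≤ 9 * b := by
    intro x hx
    rw [Finset.mem_filter] at hx
    simpa only [hx.2] using h.add_card_mul_le hanti hx.1
  have hlow : ∀ x ∈ ({x ∈ M | g x = j} : Finset ι), v z ≤ v x := fun x hx =>
    h.last_le hanti (Finset.mem_filter.1 hx).1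
  generalize ({x ∈ M | g x = j} : Finset ι) = S at *
  have h4 : S.card ≤ 4 := by
    by_contra! h5
    obtain ⟨x, hx⟩ := Finset.card_pos.1 (show 0 < S.card by omega)
    have h6 : (5 : ℝ) ≤ S.card := by exact_mod_cast h5
    nlinarith [hadd x hx, hlow x hx]
  rcases h3.eq_or_lt with h3 | h3
  · obtain ⟨x, y, t, hxy, hyt, rfl⟩ := exists_lt_lt_of_card_eq_three h3.symm
    rw [sum_triple hxy hyt] at hpart ⊢
    have hx := hlow x (by simp)
    have hy := hlow y (by simp)
    have ht := hlow t (by simp)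
    have h1 := hanti hxy.le
    have h2 := hanti hyt.le
    unfold weight
    split_ifs <;> linarith
  · have h5 : S.card = 4 := by omega
    have h6 : ∀ x ∈ S, weight b (v z) (v x) ≤ 3 := by
      intro x hx
      have := hadd x hx
      rw [h5] at this
      push_cast at this
      rw [weight, if_pos (by linarith)]
    refine (Finset.sum_le_card_nsmul S _ 3 h6).trans ?_
    rw [h5]
    norm_num

lemma weight_bundle (h : GreedyConfig v b z a M K J g) (hv : ∀ x, 0 ≤ v x)
    (hanti : Antitone v) (hcard : ∀ j ∈ J, 3 ≤ ({x ∈ M | g x = j} : Finset ι).card)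
    (hz : 3 * v z < 7 * b) {k : ℕ} (hk : k ∈ K) :
    12 ≤ ∑ x ∈ M with a x = k, weight b (v z) (v x) ∨
      (10 ≤ ∑ x ∈ M with a x = k, weight b (v z) (v x) ∧
        (∃ x ∈ M, a x = k ∧ (11 * b - v z) / 3 < v x) ∧
        ∀ y ∈ M, k < a y → v y ≤ (11 * b - v z) / 3) := by
  have h2 := h.two_lt_last hv
  have hsum := h.lt_bundle_add_last hv hk
  have hupp : ∀ x ∈ ({x ∈ M | a x = k} : Finset ι), v x ≤ 9 * b - 2 * v z := fun x hx =>
    h.le_of_three_le_card hv hanti hcard (Finset.mem_filter.1 hx).1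
  have hmem : ∀ x, x ∈ ({x ∈ M | a x = k} : Finset ι) ↔ x ∈ M ∧ a x = k := by simp
  have hgreedy : ∀ y ∈ M, k < a y →
      11 * b < ∑ x ∈ {x ∈ M | a x = k} with x < y, v x + v y := by
    intro y hy hky
    rw [Finset.filter_filter]
    exact h.greedy k hk y hy hky
  have hupp' : ∀ x ∈ M, v x ≤ 9 * b - 2 * v z := fun x hx =>
    h.le_of_three_le_card hv hanti hcard hx
  generalize ({x ∈ M | a x = k} : Finset ι) = S at *
  by_cases h4 : 4 ≤ S.card
  · left
    have h5 : (4 : ℝ) ≤ S.card := by exact_mod_cast h4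
    have h6 := Finset.card_nsmul_le_sum S (fun x => weight b (v z) (v x)) 3
      fun x _ => three_le_weight _ _ _
    rw [nsmul_eq_mul] at h6
    linarith
  have hcases : S.card = 0 ∨ S.card = 1 ∨ S.card = 2 ∨ S.card = 3 := by omega
  rcases hcases with h0 | h1 | h2' | h3
  · rw [Finset.card_eq_zero] at h0
    subst h0
    rw [Finset.sum_empty] at hsum
    linarith
  · obtain ⟨p, rfl⟩ := Finset.card_eq_one.1 h1
    rw [Finset.sum_singleton] at hsum
    linarith [hupp p (by simp)]
  · left
    obtain ⟨p, q, hpq, rfl⟩ := Finset.card_eq_two.1 h2'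
    rw [Finset.sum_pair hpq] at hsum ⊢
    have hp := hupp p (by simp)
    have hq := hupp q (by simp)
    unfold weight
    split_ifs <;> linarith
  · obtain ⟨p, q, r, hpq, hqr, rfl⟩ := exists_lt_lt_of_card_eq_three h3
    rw [sum_triple hpq hqr] at hsum ⊢
    have h1 := hanti hpq.le
    have h2 := hanti hqr.le
    have hp := hupp p (by simp)
    rw [or_iff_not_imp_left, not_le]
    intro hlt
    have hr3 : v r ≤ (11 * b - v z) / 3 := by
      by_contra! hr
      have : ∀ c, v r ≤ c → 4 ≤ weight b (v z) c := by
        intro c hc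
        unfold weight
        split_ifs <;> linarith
      linarith [this (v p) (by linarith), this (v q) h2, this (v r) le_rfl]
    have hwp : 4 ≤ weight b (v z) (v p) := by
      unfold weight
      split_ifs <;> linarith
    have hwq := three_le_weight b (v z) (v q)
    have hwr := three_le_weight b (v z) (v r)
    refine ⟨by linarith, ⟨p, ((hmem p).1 (by simp)).1, ((hmem p).1 (by simp)).2, by linarith⟩,
      fun y hy hky => ?_⟩
    by_contra! hy3
    have hgy := hgreedy y hy hky
    have hyr : y < r := by
      by_contra! hry
      linarith [hanti hry]
    have hne : ∀ x, x ∈ ({p, q, r} : Finset ι) → x ≠ y := by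
      rintro x hx rfl
      exact hky.ne' ((hmem x).1 hx).2
    rcases (hne p (by simp)).lt_or_gt with hpy | hpy
    · have hvy := hanti hpy.le
      rcases (hne q (by simp)).lt_or_gt with hqy | hqy
      · have hvq := hanti hqy.le
        rw [show ({x ∈ ({p, q, r} : Finset ι) | x < y} : Finset ι) = {p, q} by grind,
          Finset.sum_pair hpq.ne] at hgy
        revert hlt
        unfold weight
        split_ifs <;> intro hlt <;> linarith
      · rw [show ({x ∈ ({p, q, r} : Finset ι) | x < y} : Finset ι) = {p} by grind,
          Finset.sum_singleton] at hgy
        linarith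
    · rw [show ({x ∈ ({p, q, r} : Finset ι) | x < y} : Finset ι) = ∅ by grind,
        Finset.sum_empty] at hgy
      linarith [hupp' y hy]

lemma false_of_three_le_card (h : GreedyConfig v b z a M K J g) (hv : ∀ x, 0 ≤ v x)
    (hanti : Antitone v) (hcard : ∀ j ∈ J, 3 ≤ ({x ∈ M | g x = j} : Finset ι).card) : False := by
  have h2 := h.two_lt_last hv
  have hJK : (J.card : ℝ) = K.card := by exact_mod_cast h.card_eq
  rcases lt_or_ge (3 * v z) (7 * b) with hz | hz
  · set w : ι → ℝ := fun x => weight b (v z) (v x) with hw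
    have h1 : ∑ x ∈ M, w x ≤ J.card * 12 := by
      rw [h.sum_eq_parts w, ← nsmul_eq_mul]
      exact Finset.sum_le_card_nsmul _ _ _ fun j hj => h.weight_part_le hv hanti hcard hz hj
    have hwz : 3 ≤ w z := three_le_weight _ _ _
    rw [h.sum_eq_bundles w] at h1
    by_cases hbad : ∃ k ∈ K, ∑ x ∈ M with a x = k, w x < 12
    · obtain ⟨k, hk, hk12⟩ := hbad
      obtain ⟨hk10, ⟨x, hx, hxk, hxv⟩, hsmall⟩ :=
        (h.weight_bundle hv hanti hcard hz hk).resolve_left hk12.not_ge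
      have hrest : ∀ l ∈ K.erase k, 12 ≤ ∑ x ∈ M with a x = l, w x := by
        intro l hl
        rw [Finset.mem_erase] at hl
        rcases h.weight_bundle hv hanti hcard hz hl.2 with hl12 | ⟨-, ⟨y, hy, hyl, hyv⟩, hsmall'⟩
        · exact hl12
        · rcases hl.1.lt_or_gt with hlt | hlt
          · exact absurd (hsmall' x hx (hxk ▸ hlt)) hxv.not_ge
          · exact absurd (hsmall y hy (hyl ▸ hlt)) hyv.not_ge
      have h3 := Finset.card_nsmul_le_sum _ _ _ hrest
      rw [nsmul_eq_mul, Finset.cast_card_erase_of_mem hk] at h3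
      rw [← Finset.add_sum_erase K _ hk] at h1
      linarith
    · push Not at hbad
      have h3 := Finset.card_nsmul_le_sum _ _ _ hbad
      rw [nsmul_eq_mul] at h3
      linarith
  · have hb : 0 < b := by
      by_contra! hb
      linarith [h.le_bound hv h.mem]
    have h1 := h.sum_eq_parts fun _ => 1
    rw [h.sum_eq_bundles fun _ => 1] at h1
    have h3 : ∀ j ∈ J, ∑ x ∈ M with g x = j, (1 : ℝ) ≤ 3 := by
      intro j hj
      rw [Finset.sum_const, nsmul_one]
      by_contra! h4
      obtain ⟨x, hx⟩ := Finset.card_pos.1 (show 0 < ({x ∈ M | g x = j} : Finset ι).card by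
        linarith [hcard j hj])
      rw [Finset.mem_filter] at hx
      have h5 := h.add_card_mul_le hanti hx.1
      rw [hx.2] at h5
      have h6 : (4 : ℝ) ≤ ({x ∈ M | g x = j} : Finset ι).card := by
        have : 3 < ({x ∈ M | g x = j} : Finset ι).card := by exact_mod_cast h4
        exact_mod_cast this
      nlinarith [h.last_le hanti hx.1]
    have h4 : ∀ k ∈ K, 3 ≤ ∑ x ∈ M with a x = k, (1 : ℝ) := by
      intro k hk
      rw [Finset.sum_const, nsmul_one]
      by_contra! h4
      have h5 : (({x ∈ M | a x = k} : Finset ι).card : ℝ) ≤ 2 := by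
        have : ({x ∈ M | a x = k} : Finset ι).card < 3 := by exact_mod_cast h4
        exact_mod_cast Nat.le_of_lt_succ this
      have h6 := h.lt_bundle_add_last hv hk
      have h7 := Finset.sum_le_card_nsmul ({x ∈ M | a x = k} : Finset ι) v _ fun x hx =>
        h.le_of_three_le_card hv hanti hcard (Finset.mem_filter.1 hx).1
      rw [nsmul_eq_mul] at h7
      have h8 := h.le_of_three_le_card hv hanti hcard h.mem
      nlinarith [hv z]
    have h5 := Finset.sum_le_card_nsmul _ _ _ h3
    have h6 := Finset.card_nsmul_le_sum _ _ _ h4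
    rw [nsmul_eq_mul] at h5 h6
    linarith

theorem false (h : GreedyConfig v b z a M K J g) (hv : ∀ x, 0 ≤ v x) (hanti : Antitone v) :
    False := by
  induction hn : K.card generalizing M K J g with
  | zero =>
    have := Finset.card_pos.2 ⟨_, h.part_mem z h.mem⟩
    have := h.card_eq
    omega
  | succ n ih =>
    by_cases hsmall : ∃ j ∈ J, ({x ∈ M | g x = j} : Finset ι).card ≤ 2
    · obtain ⟨j, hj, hj2⟩ := hsmall
      obtain ⟨k, hk, g', h'⟩ := h.exists_smaller hv hanti hj hj2
      refine ih h' ?_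
      rw [Finset.card_erase_of_mem hk, hn, Nat.add_sub_cancel]
    · push Not at hsmall
      exact h.false_of_three_le_card hv hanti hsmall

end GreedyConfig

/-- One round of the greedy algorithm: a bundle affordable to some agent of `S`, to which no
rejected item could have been added at its turn by any agent of `S`. -/
lemma exists_greedy_bundle {ι α : Type*} [LinearOrder ι] (v : α → ι → ℝ) (T : α → ℝ)
    (hT : ∀ i, 0 ≤ T i) {S : Finset α} (hS : S.Nonempty) (R : Finset ι) :
    ∃ B ⊆ R, ∃ i₀ ∈ S, ∑ x ∈ B, v i₀ x ≤ T i₀ ∧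
      ∀ i ∈ S, ∀ y ∈ R, y ∉ B → T i < ∑ x ∈ B with x < y, v i x + v i y := by
  induction R using Finset.induction_on_max with
  | empty =>
    obtain ⟨i, hi⟩ := hS
    exact ⟨∅, subset_rfl, i, hi, by simpa using hT i, by simp⟩
  | insert y R hy ih =>
    obtain ⟨B, hBR, i₀, hi₀, hB, hgreedy⟩ := ih
    have hyB : y ∉ B := fun hyB => (hy y (hBR hyB)).false
    by_cases hex : ∃ i ∈ S, ∑ x ∈ B, v i x + v i y ≤ T i
    · obtain ⟨i, hi, hle⟩ := hex
      refine ⟨insert y B, Finset.insert_subset_insert y hBR, i, hi, ?_, ?_⟩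
      · rw [Finset.sum_insert hyB]
        linarith
      · intro l hl t ht htB
        rw [Finset.mem_insert, not_or] at htB
        have htR := (Finset.mem_insert.1 ht).resolve_left htB.1
        rw [Finset.filter_insert, if_neg (hy t htR).not_gt]
        exact hgreedy l hl t htR htB.2
    · push Not at hex
      refine ⟨B, hBR.trans (Finset.subset_insert y R), i₀, hi₀, hB, ?_⟩
      intro l hl t ht htB
      rcases Finset.mem_insert.1 ht with rfl | htR
      · rw [Finset.filter_true_of_mem fun x hx => hy x (hBR hx)]
        exact hex l hl
      · exact hgreedy l hl t htR htB

/-- The greedy algorithm: bundle `k` goes to agent `σ k`, items with labels at least `S.card`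
are left over, and `i` is the last agent served. -/
lemma exists_greedy_labelling {ι α : Type*} [LinearOrder ι] [DecidableEq α] (v : α → ι → ℝ)
    (T : α → ℝ) (hT : ∀ i, 0 ≤ T i) {S : Finset α} (hS : S.Nonempty) (R : Finset ι) :
    ∃ (a : ι → ℕ) (σ : ℕ → α), ∃ i ∈ S, (∀ k < S.card, σ k ∈ S) ∧
      (∀ k < S.card, ∀ l < S.card, σ k = σ l → k = l) ∧
      (∀ k < S.card, ∑ x ∈ R with a x = k, v (σ k) x ≤ T (σ k)) ∧
      ∀ k < S.card, ∀ y ∈ R, k < a y →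
        T i < ∑ x ∈ R with (a x = k ∧ x < y), v i x + v i y := by
  induction hn : S.card generalizing S R with
  | zero => exact absurd hn hS.card_ne_zero
  | succ n ih =>
    obtain ⟨B, hBR, i₀, hi₀, hB, hgreedy⟩ := exists_greedy_bundle v T hT hS R
    obtain ⟨a, σ, i, hi, h1, h2, h3, h4⟩ : ∃ (a : ι → ℕ) (σ : ℕ → α), ∃ i ∈ S,
        (∀ k < n, σ k ∈ S.erase i₀) ∧ (∀ k < n, ∀ l < n, σ k = σ l → k = l) ∧
        (∀ k < n, ∑ x ∈ R \ B with a x = k, v (σ k) x ≤ T (σ k)) ∧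
        ∀ k < n, ∀ y ∈ R \ B, k < a y →
          T i < ∑ x ∈ R \ B with (a x = k ∧ x < y), v i x + v i y := by
      have hcard : (S.erase i₀).card = n := by
        rw [Finset.card_erase_of_mem hi₀, hn, Nat.add_sub_cancel]
      rcases (S.erase i₀).eq_empty_or_nonempty with he | hne
      · have h0 : n = 0 := by rw [← hcard, he, Finset.card_empty]
        subst h0
        exact ⟨fun _ => 0, fun _ => i₀, i₀, hi₀, by simp⟩
      · obtain ⟨a, σ, i, hi, h⟩ := ih hne (R \ B) hcard
        exact ⟨a, σ, i, Finset.mem_of_mem_erase hi, h⟩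
    have hfil0 : ({x ∈ R | (if x ∈ B then 0 else a x + 1) = 0} : Finset ι) = B := by
      ext x
      simp only [Finset.mem_filter]
      by_cases hx : x ∈ B
      · simp [hx, hBR hx]
      · simp [hx]
    have hfil : ∀ k, ({x ∈ R | (if x ∈ B then 0 else a x + 1) = k + 1} : Finset ι) =
        {x ∈ R \ B | a x = k} := by
      intro k
      ext x
      simp only [Finset.mem_filter, Finset.mem_sdiff]
      by_cases hx : x ∈ B <;> simp [hx]
    refine ⟨fun x => if x ∈ B then 0 else a x + 1, fun k => Nat.casesOn k i₀ σ, i, hi,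
      ?_, ?_, ?_, ?_⟩
    · rintro (_ | k) hk
      · exact hi₀
      · exact Finset.mem_of_mem_erase (h1 k (by omega))
    · rintro (_ | k) hk (_ | l) hl e
      · rfl
      · exact absurd e.symm (Finset.ne_of_mem_erase (h1 l (by omega)))
      · exact absurd e (Finset.ne_of_mem_erase (h1 k (by omega)))
      · rw [h2 k (by omega) l (by omega) e]
    · rintro (_ | k) hk
      · rw [hfil0]
        exact hB
      · rw [hfil]
        exact h3 k (by omega)
    · rintro (_ | k) hk y hy hky
      · have hyB : y ∉ B := fun hyB => by simp [hyB] at hky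
        rw [← Finset.filter_filter, hfil0]
        exact hgreedy i hi y hy hyB
      · have hyB : y ∉ B := fun hyB => by simp [hyB] at hky
        rw [← Finset.filter_filter, hfil, Finset.filter_filter]
        refine h4 k (by omega) y (Finset.mem_sdiff.2 ⟨hy, hyB⟩) ?_
        simpa [hyB] using hky

/-- Reduction to identically ordered costs: if agent `o x` accepts her `x`-th most costly item for
every `x`, then the items themselves can be distributed at no higher cost. -/
lemma exists_perm_le_sorted {α : Type*} {m : ℕ} (c : α → Fin m → ℝ) (π : α → Equiv.Perm (Fin m))
    (hπ : ∀ i, Antitone (c i ∘ π i)) (o : Fin m → α) :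
    ∃ φ : Fin m → Fin m, Function.Bijective φ ∧ ∀ x, c (o x) (φ x) ≤ c (o x) (π (o x) x) := by
  classical
  obtain ⟨φ, hinj, hφ⟩ := (Finset.all_card_le_biUnion_card_iff_exists_injective
    fun x => ({y | c (o x) y ≤ c (o x) (π (o x) x)} : Finset (Fin m))).1 (by
      intro s
      rcases s.eq_empty_or_nonempty with rfl | hs
      · simp
      set x := s.min' hs
      have h1 : s ⊆ Finset.Ici x := fun y hy => Finset.mem_Ici.2 (s.min'_le y hy)
      have h2 : (Finset.Ici x).image (π (o x)) ⊆
          s.biUnion fun x => ({y | c (o x) y ≤ c (o x) (π (o x) x)} : Finset (Fin m)) := by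
        intro y hy
        obtain ⟨t, ht, rfl⟩ := Finset.mem_image.1 hy
        refine Finset.mem_biUnion.2 ⟨x, s.min'_mem hs, ?_⟩
        simpa using hπ (o x) (Finset.mem_Ici.1 ht)
      calc s.card ≤ (Finset.Ici x).card := Finset.card_le_card h1
        _ = ((Finset.Ici x).image (π (o x))).card :=
          (Finset.card_image_of_injective _ (π (o x)).injective).symm
        _ ≤ _ := Finset.card_le_card h2)
  exact ⟨φ, Finite.injective_iff_bijective.1 hinj, fun x => by simpa using hφ x⟩

/-- For identically ordered costs, and parts of cost at most `9 * b i` for each agent `i`, there is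
an allocation of cost at most `11 * b i` for each agent `i`. -/
lemma exists_allocation_of_antitone {n m : ℕ} (hn : 1 ≤ n) (v : Fin n → Fin m → ℝ)
    (hv : ∀ i x, 0 ≤ v i x) (hanti : ∀ i, Antitone (v i)) (b : Fin n → ℝ) (hb : ∀ i, 0 ≤ b i)
    (g : Fin n → Fin m → Fin n) (hg : ∀ i j, ∑ x with g i x = j, v i x ≤ 9 * b i) :
    ∃ o : Fin m → Fin n, ∀ i, ∑ x with o x = i, v i x ≤ 11 * b i := by
  have hne : (Finset.univ : Finset (Fin n)).Nonempty := ⟨⟨0, hn⟩, Finset.mem_univ _⟩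
  obtain ⟨a, σ, i, -, -, hσ, hbundle, hgreedy⟩ := exists_greedy_labelling v
    (fun i => 11 * b i) (fun i => by linarith [hb i]) hne Finset.univ
  simp only [Finset.card_univ, Fintype.card_fin, Finset.mem_univ, forall_const] at *
  have hlt : ∀ x, a x < n := by
    by_contra! hex
    obtain ⟨x, hx⟩ := hex
    have hs : (Finset.univ.filter fun x => n ≤ a x).Nonempty := ⟨x, by simpa using hx⟩
    set z := (Finset.univ.filter fun x => n ≤ a x).min' hs
    have hz : n ≤ a z := by simpa using Finset.min'_mem _ hs
    have hmin : ∀ x < z, a x < n := by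
      intro x hxz
      by_contra! hx
      exact (Finset.min'_le _ x (by simpa using hx)).not_gt hxz
    refine GreedyConfig.false (v := v i) (b := b i) (z := z) (a := a) (M := Finset.Iic z)
      (K := Finset.range n) (J := Finset.range n) (g := fun x => (g i x : ℕ)) ?_ (hv i) (hanti i)
    refine ⟨rfl, by simp, by simp, ?_, ?_, ?_, by simp, ?_⟩
    · intro x hx hxz
      exact Finset.mem_range.2 (hmin x (lt_of_le_of_ne (Finset.mem_Iic.1 hx) hxz))
    · exact fun k hk => (Finset.mem_range.1 hk).trans_le hz
    · intro k hk y hy hky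
      convert hgreedy k (Finset.mem_range.1 hk) y hky using 3
      ext x
      simp only [Finset.mem_filter, Finset.mem_Iic, Finset.mem_univ, true_and]
      exact and_iff_right_of_imp fun hx => hx.2.le.trans (Finset.mem_Iic.1 hy)
    · intro j hj
      refine le_trans (Finset.sum_le_sum_of_subset_of_nonneg ?_ fun x _ _ => hv i x)
        (hg i ⟨j, Finset.mem_range.1 hj⟩)
      intro x hx
      simpa [Fin.ext_iff] using (Finset.mem_filter.1 hx).2
  refine ⟨fun x => σ (a x), fun l => ?_⟩
  by_cases hl : ∃ k < n, σ k = l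
  · obtain ⟨k, hk, rfl⟩ := hl
    convert hbundle k hk using 3 with x
    exact ⟨hσ _ (hlt x) _ hk, fun e => congrArg σ e⟩
  · push Not at hl
    rw [Finset.filter_false_of_mem fun x _ => hl _ (hlt x), Finset.sum_empty]
    linarith [hb l]

/-- For every number of agents `n ≥ 1` and every finite set of `m` indivisible
chores with additive cost functions (nonnegative item costs), there exists a complete
allocation that is `11/9`-MMS for chores: every agent `i` incurs cost at most
`(11/9)·MMS_i`, where `MMS_i` is the minimax share (so the bound holds against the maximum
bundle of every partition). -/
theorem approx_mms_exists_chores (n m : ℕ) (hn : 1 ≤ n)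
    (c : Fin n → Fin m → ℝ)
    (hc : ∀ i k, 0 ≤ c i k) :
    ∃ A : Fin n → Finset (Fin m),
      (∀ i j, i ≠ j → Disjoint (A i) (A j)) ∧
      Finset.univ.biUnion A = Finset.univ ∧
      ∀ i : Fin n, ∀ P : Fin n → Finset (Fin m),
        (∀ j l, j ≠ l → Disjoint (P j) (P l)) →
        Finset.univ.biUnion P = Finset.univ →
        (∑ k ∈ A i, c i k) ≤
          (11 / 9) *
            Finset.univ.sup' (Finset.univ_nonempty_iff.mpr ⟨⟨0, hn⟩⟩)
              (fun j => ∑ k ∈ P j, c i k) := by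
  have hne : (Finset.univ : Finset (Fin n)).Nonempty :=
    Finset.univ_nonempty_iff.mpr ⟨⟨0, hn⟩⟩
  have hmin : ∀ i, ∃ g : Fin m → Fin n, ∀ g' : Fin m → Fin n,
      Finset.univ.sup' hne (fun j => ∑ k with g k = j, c i k) ≤
        Finset.univ.sup' hne (fun j => ∑ k with g' k = j, c i k) := by
    intro i
    obtain ⟨g, -, hg⟩ := Finset.exists_min_image (Finset.univ : Finset (Fin m → Fin n))
      (fun g => Finset.univ.sup' hne (fun j => ∑ k with g k = j, c i k))
      ⟨fun _ => ⟨0, hn⟩, Finset.mem_univ _⟩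
    exact ⟨g, fun g' => hg g' (Finset.mem_univ _)⟩
  choose g hg using hmin
  set s : Fin n → ℝ := fun i => Finset.univ.sup' hne (fun j => ∑ k with g i k = j, c i k)
  have hle : ∀ i j, ∑ k with g i k = j, c i k ≤ s i := fun i j =>
    Finset.le_sup' (fun j => ∑ k with g i k = j, c i k) (Finset.mem_univ j)
  have hs0 : ∀ i, 0 ≤ s i := fun i =>
    (Finset.sum_nonneg fun k _ => hc i k).trans (hle i ⟨0, hn⟩)
  set π : Fin n → Equiv.Perm (Fin m) := fun i => Tuple.sort fun k => -c i k
  have hπ : ∀ i, Antitone (c i ∘ π i) := fun i x y hxy => by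
    simpa using Tuple.monotone_sort (fun k => -c i k) hxy
  obtain ⟨o, ho⟩ := exists_allocation_of_antitone hn (fun i => c i ∘ π i) (fun i x => hc i _) hπ
    (fun i => s i / 9) (fun i => by linarith [hs0 i]) (fun i x => g i (π i x)) (fun i j => by
      have h1 : ∑ x with g i (π i x) = j, (c i ∘ π i) x = ∑ k with g i k = j, c i k := by
        rw [Finset.sum_filter, Finset.sum_filter]
        exact Equiv.sum_comp (π i) fun k => if g i k = j then c i k else 0
      rw [h1]
      linarith [hle i j])
  obtain ⟨φ, hφ, hcφ⟩ := exists_perm_le_sorted c π hπ o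
  refine ⟨fun i => (Finset.univ.filter fun x => o x = i).image φ, ?_, ?_, ?_⟩
  · intro i j hij
    rw [Finset.disjoint_image hφ.1]
    exact Finset.disjoint_filter.2 fun x _ hi hj => hij (hi.symm.trans hj)
  · ext k
    obtain ⟨x, rfl⟩ := hφ.2 k
    simp only [Finset.mem_biUnion, Finset.mem_univ, true_and, iff_true]
    exact ⟨o x, Finset.mem_image_of_mem φ (by simp)⟩
  · intro i P hP hcov
    have hmem : ∀ k, ∃ j, k ∈ P j := fun k => by
      simpa using hcov.ge (Finset.mem_univ k)
    choose p hp using hmem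
    have hPeq : ∀ j, P j = Finset.univ.filter fun k => p k = j := by
      intro j
      ext k
      simp only [Finset.mem_filter, Finset.mem_univ, true_and]
      refine ⟨fun hk => ?_, fun e => e ▸ hp k⟩
      by_contra hne'
      exact Finset.disjoint_left.1 (hP _ _ hne') (hp k) hk
    have h1 : s i ≤ Finset.univ.sup' hne (fun j => ∑ k ∈ P j, c i k) := by
      simp only [hPeq]
      exact hg i p
    have h2 : ∑ x with o x = i, c i (φ x) ≤ ∑ x with o x = i, (c i ∘ π i) x := by
      refine Finset.sum_le_sum fun x hx => ?_
      obtain rfl : o x = i := (Finset.mem_filter.1 hx).2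
      exact hcφ x
    rw [Finset.sum_image fun x _ y _ e => hφ.1 e]
    have h3 := ho i
    have h4 : (11 / 9 : ℝ) * s i ≤
        11 / 9 * Finset.univ.sup' hne (fun j => ∑ k ∈ P j, c i k) := by gcongr
    linarith
end
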